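/- Suppose N ≥ 2 is an integer, δ, μ > 0 satisfy condition (H₁), and 2N/(N+1) < p ≤ 2 and 2N/(N+1) < q ≤ 2. If 1/(δ+1) + 1/(μ+1) > (N − m)/(N(m−1)), where m = min{p,q}, then for every R > 0 the system (S_R) possesses a regular radial solution (u,v). -/

import Mathlib

/-- A regular radial solution of system (S_R) on the ball of radius `R`. -/
def IsRadialSolution (N : ℕ) (p q δ μ R : ℝ) (u v : ℝ → ℝ) : Prop :=
  ContDiffOn ℝ 1 u (Set.Icc 0 R) ∧ ContDiffOn ℝ 1 v (Set.Icc 0 R) ∧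
  ContDiffOn ℝ 2 u (Set.Ioc 0 R) ∧ ContDiffOn ℝ 2 v (Set.Ioc 0 R) ∧
  (∀ r ∈ Set.Ico (0:ℝ) R, 0 < u r) ∧ (∀ r ∈ Set.Ico (0:ℝ) R, 0 < v r) ∧
  deriv u 0 = 0 ∧ deriv v 0 = 0 ∧ u R = 0 ∧ v R = 0 ∧
  (∀ r ∈ Set.Ioc (0:ℝ) R,
    deriv (fun s => s ^ ((N:ℝ) - 1) * |deriv u s| ^ (p - 2) * deriv u s) r
      = -(r ^ ((N:ℝ) - 1) * v r ^ δ)) ∧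
  (∀ r ∈ Set.Ioc (0:ℝ) R,
    deriv (fun s => s ^ ((N:ℝ) - 1) * |deriv v s| ^ (q - 2) * deriv v s) r
      = -(r ^ ((N:ℝ) - 1) * u r ^ μ))

open Set Filter Topology MeasureTheory

/-- The weighted average `s ^ (-n) * ∫₀ˢ t ^ n * h t dt`, extended by zero to `s ≤ 0`. -/
noncomputable def radialFlux (n : ℕ) (h : ℝ → ℝ) (s : ℝ) : ℝ :=
  (∫ t in (0:ℝ)..max s 0, t ^ n * h t) / (max s 0) ^ n

/-- The integral of the power `α` of the radial flux of `h`. -/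
noncomputable def radialPot (n : ℕ) (α : ℝ) (h : ℝ → ℝ) (r : ℝ) : ℝ :=
  ∫ s in (0:ℝ)..r, (radialFlux n h s) ^ α

/-- Measurable functions with values in `[0, M]`. -/
def IsBddSource (h : ℝ → ℝ) (M : ℝ) : Prop :=
  Measurable h ∧ ∀ t, 0 ≤ h t ∧ h t ≤ M

theorem radialFlux_of_nonpos {n : ℕ} {h : ℝ → ℝ} {s : ℝ} (hs : s ≤ 0) : radialFlux n h s = 0 := by
  simp [radialFlux, max_eq_right hs]

namespace IsBddSource

variable {n : ℕ} {α M : ℝ} {h g : ℝ → ℝ}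

theorem nonneg (hh : IsBddSource h M) (t : ℝ) : 0 ≤ h t := (hh.2 t).1

theorem le (hh : IsBddSource h M) (t : ℝ) : h t ≤ M := (hh.2 t).2

theorem bound_nonneg (hh : IsBddSource h M) : 0 ≤ M := (hh.nonneg 0).trans (hh.le 0)

theorem intervalIntegrable (hh : IsBddSource h M) (n : ℕ) (a b : ℝ) :
    IntervalIntegrable (fun t => t ^ n * h t) volume a b := by
  have h1 : IntervalIntegrable h volume a b := by
    refine (intervalIntegrable_const (c := M)).mono_fun hh.1.aestronglyMeasurable ?_
    refine Eventually.of_forall fun t => ?_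
    simpa only [Real.norm_of_nonneg (hh.nonneg t), Real.norm_of_nonneg hh.bound_nonneg]
      using hh.le t
  exact h1.continuousOn_mul (by fun_prop)

theorem flux_nonneg (hh : IsBddSource h M) (s : ℝ) : 0 ≤ radialFlux n h s := by
  refine div_nonneg (intervalIntegral.integral_nonneg (le_max_right _ _) fun t ht => ?_)
    (pow_nonneg (le_max_right _ _) _)
  exact mul_nonneg (pow_nonneg ht.1 _) (hh.nonneg t)

theorem flux_mono (hh : IsBddSource h M) {M' : ℝ} (hg : IsBddSource g M') {s : ℝ}
    (hle : ∀ t, 0 ≤ t → t ≤ s → h t ≤ g t) : radialFlux n h s ≤ radialFlux n g s := by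
  rcases le_or_gt s 0 with hs | hs
  · rw [radialFlux_of_nonpos hs, radialFlux_of_nonpos hs]
  · refine div_le_div_of_nonneg_right ?_ (pow_nonneg (le_max_right _ _) _)
    refine intervalIntegral.integral_mono_on (le_max_right _ _) (hh.intervalIntegrable n _ _)
      (hg.intervalIntegrable n _ _) fun t ht => ?_
    rw [max_eq_left hs.le] at ht
    exact mul_le_mul_of_nonneg_left (hle t ht.1 ht.2) (pow_nonneg ht.1 _)

end IsBddSource

theorem isBddSource_const {c : ℝ} (hc : 0 ≤ c) : IsBddSource (fun _ => c) c :=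
  ⟨measurable_const, fun _ => ⟨hc, le_rfl⟩⟩

theorem radialFlux_const (n : ℕ) (hn : 1 ≤ n) (c s : ℝ) :
    radialFlux n (fun _ => c) s = c * max s 0 / (n + 1) := by
  unfold radialFlux
  rw [intervalIntegral.integral_mul_const, integral_pow]
  rcases (le_max_right s 0).eq_or_lt with h0 | h0
  · rw [← h0]; simp
  · have : (n:ℝ) + 1 ≠ 0 := by positivity
    field_simp
    simp
    ring

namespace IsBddSource

variable {n : ℕ} {α M : ℝ} {h g : ℝ → ℝ}

theorem flux_le (hh : IsBddSource h M) (hn : 1 ≤ n) (s : ℝ) :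
    radialFlux n h s ≤ M * max s 0 := by
  refine (hh.flux_mono (isBddSource_const hh.bound_nonneg) fun t _ _ => hh.le t).trans ?_
  rw [radialFlux_const n hn]
  exact div_le_self (mul_nonneg hh.bound_nonneg (le_max_right _ _)) (by simp)

theorem flux_continuous (hh : IsBddSource h M) (hn : 1 ≤ n) : Continuous (radialFlux n h) := by
  rw [continuous_iff_continuousAt]
  intro s
  have hm : Continuous fun s : ℝ => max s 0 := by fun_prop
  rcases le_or_gt s 0 with hs | hs
  · rw [ContinuousAt, radialFlux_of_nonpos hs]
    refine squeeze_zero (fun t => hh.flux_nonneg t) (fun t => hh.flux_le hn t) ?_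
    have : Tendsto (fun t : ℝ => M * max t 0) (𝓝 s) (𝓝 (M * max s 0)) :=
      (continuous_const.mul hm).tendsto s
    simpa [max_eq_right hs] using this
  · have hc : Continuous fun s : ℝ => ∫ t in (0:ℝ)..s, t ^ n * h t :=
      intervalIntegral.continuous_primitive (fun a b => hh.intervalIntegrable n a b) 0
    refine ((hc.comp hm).continuousAt).div (hm.pow n).continuousAt ?_
    rw [max_eq_left hs.le]
    positivity

theorem flux_rpow_continuous (hh : IsBddSource h M) (hn : 1 ≤ n) (hα : 1 ≤ α) :
    Continuous fun s => (radialFlux n h s) ^ α :=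
  (hh.flux_continuous hn).rpow_const fun _ => Or.inr (by linarith)

theorem hasDerivAt_pot (hh : IsBddSource h M) (hn : 1 ≤ n) (hα : 1 ≤ α) (r : ℝ) :
    HasDerivAt (radialPot n α h) ((radialFlux n h r) ^ α) r :=
  (hh.flux_rpow_continuous hn hα).integral_hasStrictDerivAt 0 r |>.hasDerivAt

theorem pot_continuous (hh : IsBddSource h M) (hn : 1 ≤ n) (hα : 1 ≤ α) :
    Continuous (radialPot n α h) :=
  continuous_iff_continuousAt.2 fun r => (hh.hasDerivAt_pot hn hα r).continuousAt

theorem pot_monotone (hh : IsBddSource h M) (hn : 1 ≤ n) (hα : 1 ≤ α) :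
    Monotone (radialPot n α h) :=
  monotone_of_deriv_nonneg (fun r => (hh.hasDerivAt_pot hn hα r).differentiableAt) fun r => by
    rw [(hh.hasDerivAt_pot hn hα r).deriv]
    exact Real.rpow_nonneg (hh.flux_nonneg r) _

theorem _root_.radialPot_of_nonpos (hα : 1 ≤ α) {r : ℝ} (hr : r ≤ 0) : radialPot n α h r = 0 := by
  unfold radialPot
  rw [intervalIntegral.integral_congr (g := fun _ => (0:ℝ))]
  · simp
  · intro s hs
    rw [uIcc_of_ge hr] at hs
    simp only [radialFlux_of_nonpos hs.2]
    exact Real.zero_rpow (by linarith)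

theorem pot_nonneg (hh : IsBddSource h M) (hn : 1 ≤ n) (hα : 1 ≤ α) (r : ℝ) :
    0 ≤ radialPot n α h r := by
  rcases le_total r 0 with hr | hr
  · rw [radialPot_of_nonpos hα hr]
  · have := hh.pot_monotone hn hα hr
    rwa [radialPot_of_nonpos hα le_rfl] at this

theorem pot_mono (hh : IsBddSource h M) {M' : ℝ} (hg : IsBddSource g M') (hn : 1 ≤ n)
    (hα : 1 ≤ α) {r : ℝ} (hle : ∀ t, 0 ≤ t → t ≤ r → h t ≤ g t) :
    radialPot n α h r ≤ radialPot n α g r := by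
  rcases le_total r 0 with hr | hr
  · rw [radialPot_of_nonpos hα hr, radialPot_of_nonpos hα hr]
  · refine intervalIntegral.integral_mono_on hr
      ((hh.flux_rpow_continuous hn hα).intervalIntegrable _ _)
      ((hg.flux_rpow_continuous hn hα).intervalIntegrable _ _) fun s hs => ?_
    exact Real.rpow_le_rpow (hh.flux_nonneg s)
      (hh.flux_mono hg fun t ht hts => hle t ht (hts.trans hs.2)) (by linarith)

/-- The potential depends continuously on the source, for bounded pointwise convergence. -/
theorem tendsto_pot {H : ℕ → ℝ → ℝ} (hH : ∀ k, IsBddSource (H k) M)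
    (hlim : ∀ t, Tendsto (fun k => H k t) atTop (𝓝 (h t))) (hn : 1 ≤ n) (hα : 1 ≤ α) (r : ℝ) :
    Tendsto (fun k => radialPot n α (H k) r) atTop (𝓝 (radialPot n α h r)) := by
  have hM := (hH 0).bound_nonneg
  refine intervalIntegral.tendsto_integral_filter_of_dominated_convergence
    (fun s => (M * max s 0) ^ α) ?_ ?_ ?_ ?_
  · exact Eventually.of_forall fun k =>
      ((hH k).flux_rpow_continuous hn hα).aestronglyMeasurable
  · refine Eventually.of_forall fun k => Eventually.of_forall fun s _ => ?_
    rw [Real.norm_of_nonneg (Real.rpow_nonneg ((hH k).flux_nonneg s) _)]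
    exact Real.rpow_le_rpow ((hH k).flux_nonneg s) ((hH k).flux_le hn s) (by linarith)
  · refine Continuous.intervalIntegrable ?_ _ _
    exact (by fun_prop : Continuous fun s : ℝ => M * max s 0).rpow_const
      fun _ => Or.inr (by linarith)
  · refine Eventually.of_forall fun s _ => ?_
    refine Tendsto.rpow_const ?_ (Or.inr (by linarith))
    refine Tendsto.div_const ?_ _
    refine intervalIntegral.tendsto_integral_filter_of_dominated_convergence
      (fun t => |t| ^ n * M) ?_ ?_ ?_ ?_
    · exact Eventually.of_forall fun k =>
        ((measurable_id.pow_const n).mul (hH k).1).aestronglyMeasurable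
    · refine Eventually.of_forall fun k => Eventually.of_forall fun t _ => ?_
      rw [norm_mul, norm_pow, Real.norm_eq_abs, Real.norm_of_nonneg ((hH k).nonneg t)]
      exact mul_le_mul_of_nonneg_left ((hH k).le t) (by positivity)
    · exact Continuous.intervalIntegrable (by fun_prop) _ _
    · exact Eventually.of_forall fun t _ => (hlim t).const_mul _

theorem _root_.hasDerivAt_pow_mul_radialFlux (hc : Continuous h) {r : ℝ} (hr : 0 < r) :
    HasDerivAt (fun s => s ^ n * radialFlux n h s) (r ^ n * h r) r := by
  have h1 : HasDerivAt (fun s => ∫ t in (0:ℝ)..s, t ^ n * h t) (r ^ n * h r) r :=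
    ((continuous_id.pow n).mul hc).integral_hasStrictDerivAt 0 r |>.hasDerivAt
  refine h1.congr_of_eventuallyEq ?_
  filter_upwards [lt_mem_nhds hr] with s hs
  rw [radialFlux, max_eq_left hs.le]
  field_simp

theorem _root_.hasDerivAt_radialFlux (hc : Continuous h) {r : ℝ} (hr : 0 < r) :
    HasDerivAt (radialFlux n h) (h r - n * radialFlux n h r / r) r := by
  have h1 := (hasDerivAt_pow_mul_radialFlux (n := n) hc hr).div (hasDerivAt_pow n r) (by positivity)
  refine (h1.congr_of_eventuallyEq ?_).congr_deriv ?_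
  · filter_upwards [lt_mem_nhds hr] with s hs
    simp only [Pi.div_apply]
    field_simp
  · rcases n with _ | n
    · simp
    · simp only [Nat.add_sub_cancel]
      field_simp
      ring

end IsBddSource

theorem radialFlux_mul (n : ℕ) (c : ℝ) (h : ℝ → ℝ) (s : ℝ) :
    radialFlux n (fun t => c * h t) s = c * radialFlux n h s := by
  unfold radialFlux
  rw [← mul_div_assoc, ← intervalIntegral.integral_const_mul]
  congr 2
  ext t
  ring

theorem radialPot_const (n : ℕ) (α : ℝ) {c : ℝ} (hc : 0 ≤ c) (r : ℝ) :
    radialPot n α (fun _ => c) r = c ^ α * radialPot n α (fun _ => 1) r := by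
  unfold radialPot
  rw [← intervalIntegral.integral_const_mul]
  congr 1
  ext s
  have := radialFlux_mul n c (fun _ => 1) s
  simp only [mul_one] at this
  rw [this, Real.mul_rpow hc ((isBddSource_const zero_le_one).flux_nonneg s)]

theorem radialPot_one_pos {n : ℕ} (hn : 1 ≤ n) {α : ℝ} (hα : 1 ≤ α) :
    0 < radialPot n α (fun _ => 1) 1 := by
  have h1 := isBddSource_const zero_le_one
  refine intervalIntegral.intervalIntegral_pos_of_pos_on
    ((h1.flux_rpow_continuous hn hα).intervalIntegrable _ _) (fun s hs => ?_) zero_lt_one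
  rw [radialFlux_const n hn, max_eq_left hs.1.le]
  have := hs.1
  positivity

/-- One half of a positive radial solution on `(0, ∞)`: `u' = -f ^ α` and
`(r ^ n f)' = r ^ n v ^ δ`, with the behaviour at the origin of regular solutions. -/
structure IsPosHalf (n : ℕ) (α δ : ℝ) (u f v : ℝ → ℝ) : Prop where
  u_pos : ∀ r, 0 < r → 0 < u r
  f_pos : ∀ r, 0 < r → 0 < f r
  deriv_u : ∀ r, 0 < r → HasDerivAt u (-(f r) ^ α) r
  deriv_f : ∀ r, 0 < r → HasDerivAt f (v r ^ δ - n * f r / r) r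
  le_f : ∀ r, 0 < r → r * v r ^ δ ≤ (n + 1) * f r
  f_zero : Tendsto f (𝓝[>] 0) (𝓝 0)
  u_bdd : ∃ M, ∀ r, 0 < r → u r ≤ M

namespace IsPosHalf

variable {n : ℕ} {α δ : ℝ} {u f v : ℝ → ℝ}

theorem pow_mul_monotoneOn (h : IsPosHalf n α δ u f v) (hv : ∀ r, 0 < r → 0 < v r) :
    MonotoneOn (fun r => r ^ n * f r) (Ioi 0) := by
  have hd : ∀ r, 0 < r → HasDerivAt (fun r => r ^ n * f r) (r ^ n * v r ^ δ) r := by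
    intro r hr
    refine ((hasDerivAt_pow n r).mul (h.deriv_f r hr)).congr_deriv ?_
    rcases n with _ | n
    · simp
    · simp only [Nat.add_sub_cancel]
      field_simp
      ring
  refine monotoneOn_of_deriv_nonneg (convex_Ioi 0)
    (fun r hr => (hd r hr).continuousAt.continuousWithinAt)
    (fun r hr => (hd r (by simpa using hr)).differentiableAt.differentiableWithinAt) fun r hr => ?_
  have hr : 0 < r := by simpa using hr
  rw [(hd r hr).deriv]
  have := hv r hr
  positivity

theorem mul_rpow_le (h : IsPosHalf n α δ u f v) (hv : ∀ r, 0 < r → 0 < v r) (hα : 1 ≤ α)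
    {r : ℝ} (hr : 0 < r) : r * f r ^ α ≤ (2 ^ n) ^ α * u r := by
  have hfr := h.f_pos r hr
  obtain ⟨c, hc, hcd⟩ := exists_hasDerivAt_eq_slope u (fun r => -(f r) ^ α)
    (show r < 2 * r by linarith)
    (fun s hs => (h.deriv_u s (hr.trans_le hs.1)).continuousAt.continuousWithinAt)
    (fun s hs => h.deriv_u s (hr.trans hs.1))
  have hc0 : 0 < c := hr.trans hc.1
  have h1 : r ^ n * f r ≤ c ^ n * f c := h.pow_mul_monotoneOn hv hr hc0 hc.1.le
  have h2 : f r ≤ 2 ^ n * f c := by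
    have h3 : c ^ n ≤ (2 * r) ^ n := pow_le_pow_left₀ hc0.le hc.2.le n
    have h4 : r ^ n * f r ≤ r ^ n * (2 ^ n * f c) := by
      refine h1.trans ((mul_le_mul_of_nonneg_right h3 (h.f_pos c hc0).le).trans_eq ?_)
      rw [mul_pow]; ring
    exact le_of_mul_le_mul_left h4 (by positivity)
  have h5 : f r ^ α ≤ (2 ^ n) ^ α * f c ^ α := by
    rw [← Real.mul_rpow (by positivity) (h.f_pos c hc0).le]
    exact Real.rpow_le_rpow hfr.le h2 (by linarith)
  have h6 : r * f c ^ α ≤ u r := by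
    have h7 : u r - u (2 * r) = r * f c ^ α := by
      rw [eq_div_iff (by linarith)] at hcd
      linarith
    have := h.u_pos (2 * r) (by linarith)
    linarith
  calc r * f r ^ α ≤ r * ((2 ^ n) ^ α * f c ^ α) := mul_le_mul_of_nonneg_left h5 hr.le
    _ = (2 ^ n) ^ α * (r * f c ^ α) := by ring
    _ ≤ _ := mul_le_mul_of_nonneg_left h6 (by positivity)

theorem hasDerivAt_X (h : IsPosHalf n α δ u f v) {r : ℝ} (hr : 0 < r) :
    HasDerivAt (fun r => r * f r ^ α / u r)
      (r * f r ^ α / u r * (r * f r ^ α / u r - (n * α - 1) + α * (r * v r ^ δ / f r)) / r) r := by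
  have hf := h.f_pos r hr
  have hu := h.u_pos r hr
  have h1 := (((hasDerivAt_id r).mul ((h.deriv_f r hr).rpow_const (p := α) (Or.inl hf.ne'))).div
    (h.deriv_u r hr) hu.ne')
  refine h1.congr_deriv ?_
  simp only [id, Pi.mul_apply]
  rw [Real.rpow_sub_one hf.ne']
  field_simp
  ring

theorem hasDerivAt_Z (h : IsPosHalf n α δ u f v) {r Q : ℝ} (hr : 0 < r) (hv : 0 < v r)
    (hQ : HasDerivAt v (-Q) r) :
    HasDerivAt (fun r => r * v r ^ δ / f r)
      (r * v r ^ δ / f r * (n + 1 - δ * (r * Q / v r) - r * v r ^ δ / f r) / r) r := by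
  have hf := h.f_pos r hr
  have h1 := (((hasDerivAt_id r).mul (hQ.rpow_const (p := δ) (Or.inl hv.ne'))).div
    (h.deriv_f r hr) hf.ne')
  refine h1.congr_deriv ?_
  simp only [id, Pi.mul_apply]
  rw [Real.rpow_sub_one hv.ne']
  field_simp
  ring

/-- The decay inequality, in logarithmic form. -/
theorem log_le (h : IsPosHalf n α δ u f v) (hv : ∀ r, 0 < r → 0 < v r) (hα : 1 ≤ α) :
    ∃ c, ∀ r, 0 < r →
      α * δ * Real.log (v r) + (α + 1) * Real.log r - c ≤ Real.log (u r) := by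
  refine ⟨Real.log ((2 ^ n) ^ α) + α * Real.log (n + 1), fun r hr => ?_⟩
  have hf := h.f_pos r hr
  have hu := h.u_pos r hr
  have hv := hv r hr
  have h1 := Real.log_le_log (by positivity) (h.mul_rpow_le ‹_› hα hr)
  have h2 := Real.log_le_log (by positivity) (h.le_f r hr)
  rw [Real.log_mul (by positivity) (by positivity), Real.log_mul (by positivity) (by positivity),
    Real.log_rpow hf] at h1
  rw [Real.log_mul (by positivity) (by positivity), Real.log_mul (by positivity) (by positivity),
    Real.log_rpow hv] at h2
  have h3 := mul_le_mul_of_nonneg_left h2 (show 0 ≤ α by linarith)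
  linarith

end IsPosHalf

/-- The subcriticality condition bounds the sum of the two decay exponents from below. -/
theorem decay_exponent_gt {n α β δ μ : ℝ} (hn : 1 ≤ n) (hβ : 1 ≤ β) (hαβ : β ≤ α)
    (hδ : 0 < δ) (hμ : 0 < μ) (hD : 0 < α * β * δ * μ - 1)
    (hsub : n * α - 1 < (n + 1) * (1 / (δ + 1) + 1 / (μ + 1))) :
    (n * β - 1) * (α * β * δ * μ - 1) <
      α * δ * (β + 1) + α + 1 + β * μ * (α + 1) + β + 1 := by
  have hα : 1 ≤ α := hβ.trans hαβ
  set D := α * β * δ * μ - 1 with hDdef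
  set γ := (α * δ * (β + 1) + α + 1) / D with hγ
  set ξ := (β * μ * (α + 1) + β + 1) / D with hξ
  have hγ0 : 0 < γ := by positivity
  have hξ0 : 0 < ξ := by positivity
  have hγD : γ * D = α * δ * (β + 1) + α + 1 := div_mul_cancel₀ _ hD.ne'
  have hξD : ξ * D = β * μ * (α + 1) + β + 1 := div_mul_cancel₀ _ hD.ne'
  have e1 : α * δ * ξ = γ + α + 1 := by
    apply mul_right_cancel₀ hD.ne'
    linear_combination (α * δ) * hξD - hγD - (α + 1) * hDdef
  have e2 : β * μ * γ = ξ + β + 1 := by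
    apply mul_right_cancel₀ hD.ne'
    linear_combination (β * μ) * hγD - hξD - (β + 1) * hDdef
  set x := 1 / (δ + 1) with hx
  set y := 1 / (μ + 1) with hy
  have hx0 : 0 < x := by positivity
  have hy0 : 0 < y := by positivity
  have hx1 : x * (δ + 1) = 1 := by rw [hx]; field_simp
  have hy1 : y * (μ + 1) = 1 := by rw [hy]; field_simp
  have i1 : x * (γ + ξ + α + 1) ≤ α * ξ := by
    have : γ + ξ + α + 1 ≤ (δ + 1) * (α * ξ) := by nlinarith
    calc _ ≤ x * ((δ + 1) * (α * ξ)) := mul_le_mul_of_nonneg_left this hx0.le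
      _ = α * ξ := by rw [← mul_assoc, hx1, one_mul]
  have i2 : y * (γ + ξ + β + 1) ≤ β * γ := by
    have : γ + ξ + β + 1 ≤ (μ + 1) * (β * γ) := by nlinarith
    calc _ ≤ y * ((μ + 1) * (β * γ)) := mul_le_mul_of_nonneg_left this hy0.le
      _ = β * γ := by rw [← mul_assoc, hy1, one_mul]
  have i3 : y * (γ + ξ + α + 1) ≤ α * γ := by
    have hS : 0 ≤ γ + ξ + 1 := by linarith
    have : β * (γ + ξ + α + 1) ≤ α * (γ + ξ + β + 1) := by nlinarith
    have h1 : β * (y * (γ + ξ + α + 1)) ≤ β * (α * γ) := by nlinarith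
    exact le_of_mul_le_mul_left h1 (by linarith)
  have i4 : (x + y) * (γ + ξ + α + 1) ≤ α * (γ + ξ) := by linarith
  have i5 : n * α - 1 < γ + ξ := by
    have h1 : (n * α - 1) * (γ + ξ + α + 1) < (n + 1) * (x + y) * (γ + ξ + α + 1) :=
      mul_lt_mul_of_pos_right hsub (by linarith)
    have h2 : (n + 1) * ((x + y) * (γ + ξ + α + 1)) ≤ (n + 1) * (α * (γ + ξ)) :=
      mul_le_mul_of_nonneg_left i4 (by linarith)
    have h3 : (α + 1) * (n * α - 1) < (α + 1) * (γ + ξ) := by nlinarith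
    exact lt_of_mul_lt_mul_left h3 (by linarith)
  have i6 : n * β - 1 < γ + ξ := by nlinarith
  calc _ < (γ + ξ) * D := mul_lt_mul_of_pos_right i6 hD
    _ = _ := by linarith

/-- The quadratic form controlling the sign of the derivative of the energy. -/
theorem energy_quadratic_nonneg {n α β Z : ℝ} (hn : 1 ≤ n) (hβ : 1 ≤ β) (hαβ : β ≤ α)
    (hnα : n * α < n + 2) :
    0 ≤ (n + 1) * (n * (α - β)) - α * (n * (α - β)) * Z + α * (α - 1) * Z ^ 2 := by
  rcases (hβ.trans hαβ).eq_or_lt with h1 | h1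
  · have : α = β := by linarith
    subst this
    simp [← h1]
  · set e := n * (α - β) with he
    have he0 : 0 ≤ e := by rw [he]; exact mul_nonneg (by linarith) (by linarith)
    have he1 : e ≤ n * (α - 1) := by rw [he]; nlinarith
    have hα : 0 < α * (α - 1) := by nlinarith
    have h2 : α * e ≤ 4 * (n + 1) * (α - 1) := by nlinarith
    have h3 : 0 ≤ (4 * (n + 1) * (α - 1) - α * e) * (α * e) :=
      mul_nonneg (by linarith) (by nlinarith)
    have h4 : 0 ≤ 4 * (α * (α - 1)) * ((n + 1) * e - α * e * Z + α * (α - 1) * Z ^ 2) := by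
      nlinarith [sq_nonneg (2 * (α * (α - 1)) * Z - α * e)]
    exact nonneg_of_mul_nonneg_right h4 (by linarith)

/-- The derivative of the energy along the quadratic dynamical system satisfied by the
logarithmic slopes of a radial solution. -/
theorem hasDerivAt_energy {n α β δ μ r : ℝ} {φ X Y Z W : ℝ → ℝ} (hr : 0 < r) (hδ : 0 < δ)
    (hμ : 0 < μ)
    (hφ : HasDerivAt φ (φ r * (n * β - 1 - X r - Y r) / r) r)
    (hX : HasDerivAt X (X r * (X r - (n * α - 1) + α * Z r) / r) r)
    (hY : HasDerivAt Y (Y r * (Y r - (n * β - 1) + β * W r) / r) r)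
    (hZ : HasDerivAt Z (Z r * (n + 1 - δ * Y r - Z r) / r) r)
    (hW : HasDerivAt W (W r * (n + 1 - μ * X r - W r) / r) r) :
    HasDerivAt (fun r => φ r * (X r * Y r + α / (δ + 1) * (X r * Z r) + β / (μ + 1) * (Y r * W r)
        - (n + 1) / (δ + 1) * X r - (n + 1) / (μ + 1) * Y r))
      (φ r * (X r / (δ + 1) * ((n + 1) * (n * (α - β)) - α * (n * (α - β)) * Z r
          + α * (α - 1) * Z r ^ 2)
        + β * (β - 1) / (μ + 1) * (Y r * W r ^ 2)
        + X r * Y r * ((n + 1) * (1 / (δ + 1) + 1 / (μ + 1)) - (n * α - 1))) / r) r := by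
  have h := hφ.mul (((((hX.mul hY).add ((hX.mul hZ).const_mul (α / (δ + 1)))).add
    ((hY.mul hW).const_mul (β / (μ + 1)))).sub (hX.const_mul ((n + 1) / (δ + 1)))).sub
    (hY.const_mul ((n + 1) / (μ + 1))))
  refine h.congr_deriv ?_
  simp only [Pi.mul_apply, Pi.add_apply, Pi.sub_apply]
  field_simp
  ring

/-- Under the subcriticality condition there are no positive radial solutions on `(0, ∞)`. -/
theorem not_isPosHalf_of_le {n : ℕ} (hn : 1 ≤ n) {α β δ μ : ℝ} (hβ : 1 ≤ β) (hαβ : β ≤ α)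
    (hnα : n * α < n + 2) (hδ : 0 < δ) (hμ : 0 < μ) (hD : 0 < α * β * δ * μ - 1)
    (hsub : n * α - 1 < (n + 1) * (1 / (δ + 1) + 1 / (μ + 1))) {u v f g : ℝ → ℝ}
    (h1 : IsPosHalf n α δ u f v) (h2 : IsPosHalf n β μ v g u) : False := by
  have hn' : (1:ℝ) ≤ n := by exact_mod_cast hn
  have hα : 1 ≤ α := hβ.trans hαβ
  set X : ℝ → ℝ := fun r => r * f r ^ α / u r with hXdef
  set Y : ℝ → ℝ := fun r => r * g r ^ β / v r with hYdef
  set Z : ℝ → ℝ := fun r => r * v r ^ δ / f r with hZdef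
  set W : ℝ → ℝ := fun r => r * u r ^ μ / g r with hWdef
  set φ : ℝ → ℝ := fun r => r ^ (n * β - 1) * (u r * v r) with hφdef
  set E : ℝ → ℝ := fun r => φ r * (X r * Y r + α / (δ + 1) * (X r * Z r)
    + β / (μ + 1) * (Y r * W r) - (n + 1) / (δ + 1) * X r - (n + 1) / (μ + 1) * Y r) with hEdef
  have hXpos : ∀ r, 0 < r → 0 < X r := fun r hr => by
    have := h1.u_pos r hr; have := h1.f_pos r hr; simp only [hXdef]; positivity
  have hYpos : ∀ r, 0 < r → 0 < Y r := fun r hr => by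
    have := h2.u_pos r hr; have := h2.f_pos r hr; simp only [hYdef]; positivity
  have hZpos : ∀ r, 0 < r → 0 < Z r := fun r hr => by
    have := h2.u_pos r hr; have := h1.f_pos r hr; simp only [hZdef]; positivity
  have hWpos : ∀ r, 0 < r → 0 < W r := fun r hr => by
    have := h1.u_pos r hr; have := h2.f_pos r hr; simp only [hWdef]; positivity
  have hφpos : ∀ r, 0 < r → 0 < φ r := fun r hr => by
    have := h1.u_pos r hr; have := h2.u_pos r hr; simp only [hφdef]; positivity
  have hφ : ∀ r, 0 < r → HasDerivAt φ (φ r * (n * β - 1 - X r - Y r) / r) r := by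
    intro r hr
    have hu := h1.u_pos r hr
    have hv := h2.u_pos r hr
    refine ((Real.hasDerivAt_rpow_const (p := n * β - 1) (Or.inl hr.ne')).mul
      ((h1.deriv_u r hr).mul (h2.deriv_u r hr))).congr_deriv ?_
    simp only [hφdef, hXdef, hYdef, Pi.mul_apply]
    rw [Real.rpow_sub_one hr.ne' (n * β - 1)]
    field_simp
    ring
  have hE : ∀ r, 0 < r → ∃ E', 0 < E' ∧ HasDerivAt E E' r := by
    intro r hr
    refine ⟨_, ?_, hasDerivAt_energy hr hδ hμ (hφ r hr) (h1.hasDerivAt_X hr)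
      (h2.hasDerivAt_X hr) (h1.hasDerivAt_Z hr (h2.u_pos r hr) (h2.deriv_u r hr))
      (h2.hasDerivAt_Z hr (h1.u_pos r hr) (h1.deriv_u r hr))⟩
    have hX := hXpos r hr
    have hY := hYpos r hr
    have hW := hWpos r hr
    have hq := energy_quadratic_nonneg (Z := Z r) hn' hβ hαβ hnα
    refine div_pos (mul_pos (hφpos r hr) (add_pos_of_nonneg_of_pos (add_nonneg ?_ ?_) ?_)) hr
    · exact mul_nonneg (by positivity) hq
    · exact mul_nonneg (div_nonneg (mul_nonneg (by linarith) (by linarith)) (by linarith))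
        (by positivity)
    · exact mul_pos (mul_pos hX hY) (by linarith)
  have hmono : StrictMonoOn E (Ioi 0) := by
    refine strictMonoOn_of_deriv_pos (convex_Ioi 0) (fun r hr => ?_) fun r hr => ?_
    · obtain ⟨_, _, h⟩ := hE r hr
      exact h.continuousAt.continuousWithinAt
    · obtain ⟨_, h0, h⟩ := hE r (by simpa using hr)
      rwa [h.deriv]
  obtain ⟨M₁, hM₁⟩ := h1.u_bdd
  obtain ⟨M₂, hM₂⟩ := h2.u_bdd
  have hE1 : 0 ≤ E 1 := by
    have hlow : ∀ r ∈ Ioo (0:ℝ) 1, -((n + 1) / (δ + 1) * (M₂ * f r ^ α)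
        + (n + 1) / (μ + 1) * (M₁ * g r ^ β)) ≤ E 1 := by
      intro r hr
      refine le_trans ?_ (hmono hr.1 (mem_Ioi.2 zero_lt_one) hr.2).le
      have hX := hXpos r hr.1
      have hY := hYpos r hr.1
      have hZ := hZpos r hr.1
      have hW := hWpos r hr.1
      have hφ := hφpos r hr.1
      have hu := h1.u_pos r hr.1
      have hv := h2.u_pos r hr.1
      have hf := Real.rpow_pos_of_pos (h1.f_pos r hr.1) α
      have hg := Real.rpow_pos_of_pos (h2.f_pos r hr.1) β
      have hr1 : r ^ (n * β - 1) ≤ 1 :=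
        Real.rpow_le_one hr.1.le hr.2.le (by nlinarith)
      have hr2 : r ^ (n * β - 1) * r ≤ 1 := mul_le_one₀ hr1 hr.1.le hr.2.le
      have hφX : φ r * X r ≤ M₂ * f r ^ α := by
        have : φ r * X r = (r ^ (n * β - 1) * r) * (v r * f r ^ α) := by
          simp only [hφdef, hXdef]; field_simp
        rw [this]
        refine (mul_le_of_le_one_left (by positivity) hr2).trans ?_
        exact mul_le_mul_of_nonneg_right (hM₂ r hr.1) hf.le
      have hφY : φ r * Y r ≤ M₁ * g r ^ β := by
        have : φ r * Y r = (r ^ (n * β - 1) * r) * (u r * g r ^ β) := by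
          simp only [hφdef, hYdef]; field_simp
        rw [this]
        refine (mul_le_of_le_one_left (by positivity) hr2).trans ?_
        exact mul_le_mul_of_nonneg_right (hM₁ r hr.1) hg.le
      have k1 := mul_le_mul_of_nonneg_left hφX (show 0 ≤ ((n:ℝ) + 1) / (δ + 1) by positivity)
      have k2 := mul_le_mul_of_nonneg_left hφY (show 0 ≤ ((n:ℝ) + 1) / (μ + 1) by positivity)
      have k3 : 0 ≤ φ r * (X r * Y r + α / (δ + 1) * (X r * Z r)
        + β / (μ + 1) * (Y r * W r)) := by positivity
      simp only [hEdef]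
      linarith
    have hf0 : Tendsto (fun r => f r ^ α) (𝓝[>] 0) (𝓝 0) := by
      have := h1.f_zero.rpow_const (p := α) (Or.inr (by linarith))
      rwa [Real.zero_rpow (by linarith)] at this
    have hg0 : Tendsto (fun r => g r ^ β) (𝓝[>] 0) (𝓝 0) := by
      have := h2.f_zero.rpow_const (p := β) (Or.inr (by linarith))
      rwa [Real.zero_rpow (by linarith)] at this
    have hlim := (((hf0.const_mul M₂).const_mul (((n:ℝ) + 1) / (δ + 1))).add
      ((hg0.const_mul M₁).const_mul (((n:ℝ) + 1) / (μ + 1)))).neg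
    simp only [mul_zero, add_zero, neg_zero] at hlim
    exact le_of_tendsto hlim (eventually_of_mem (Ioo_mem_nhdsGT zero_lt_one) hlow)
  have hE2 : 0 < E 2 := hE1.trans_lt (hmono (by simp) (by simp) (by norm_num))
  set KX : ℝ := (2 ^ n) ^ α
  set KY : ℝ := (2 ^ n) ^ β
  have hKX : 0 < KX := by positivity
  have hKY : 0 < KY := by positivity
  set C : ℝ := KX * KY + α / (δ + 1) * (KX * (n + 1)) + β / (μ + 1) * (KY * (n + 1)) with hC
  have hCpos : 0 < C := by positivity
  have hup : ∀ r, 2 ≤ r → Real.log (E 2 / C) ≤ Real.log (φ r) := by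
    intro r hr
    have hr0 : 0 < r := by linarith
    have hX := hXpos r hr0
    have hY := hYpos r hr0
    have hZ := hZpos r hr0
    have hW := hWpos r hr0
    have hφ := hφpos r hr0
    have hX' : X r ≤ KX := (div_le_iff₀ (h1.u_pos r hr0)).2 (h1.mul_rpow_le h2.u_pos hα hr0)
    have hY' : Y r ≤ KY := (div_le_iff₀ (h2.u_pos r hr0)).2 (h2.mul_rpow_le h1.u_pos hβ hr0)
    have hZ' : Z r ≤ n + 1 := (div_le_iff₀ (h1.f_pos r hr0)).2 (h1.le_f r hr0)
    have hW' : W r ≤ n + 1 := (div_le_iff₀ (h2.f_pos r hr0)).2 (h2.le_f r hr0)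
    have hEr : E 2 ≤ E r := hmono.monotoneOn (by simp) hr0 hr
    have hle : E r ≤ φ r * C := by
      refine mul_le_mul_of_nonneg_left ?_ hφ.le
      have k1 : 0 ≤ ((n:ℝ) + 1) / (δ + 1) * X r := by positivity
      have k2 : 0 ≤ ((n:ℝ) + 1) / (μ + 1) * Y r := by positivity
      have k3 : X r * Y r + α / (δ + 1) * (X r * Z r) + β / (μ + 1) * (Y r * W r) ≤ C := by
        rw [hC]; gcongr
      linarith
    refine Real.log_le_log (by positivity) ?_
    rw [div_le_iff₀ hCpos]
    exact hEr.trans hle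
  obtain ⟨c₁, hc₁⟩ := h1.log_le h2.u_pos hα
  obtain ⟨c₂, hc₂⟩ := h2.log_le h1.u_pos hβ
  have hκ := decay_exponent_gt hn' hβ hαβ hδ hμ hD hsub
  set D := α * β * δ * μ - 1 with hDdef
  set κ := α * δ * (β + 1) + α + 1 + β * μ * (α + 1) + β + 1 - (n * β - 1) * D with hκdef
  set c := α * δ * c₂ + c₁ + β * μ * c₁ + c₂ with hcdef
  have hdec : ∀ r, 2 ≤ r → D * Real.log (E 2 / C) ≤ c - κ * Real.log r := by
    intro r hr
    have hr0 : 0 < r := by linarith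
    have hu := h1.u_pos r hr0
    have hv := h2.u_pos r hr0
    refine (mul_le_mul_of_nonneg_left (hup r hr) hD.le).trans ?_
    have hlog : Real.log (φ r) = (n * β - 1) * Real.log r
        + (Real.log (u r) + Real.log (v r)) := by
      simp only [hφdef]
      rw [Real.log_mul (by positivity) (by positivity), Real.log_mul (by positivity) (by positivity),
        Real.log_rpow hr0]
    have k1 := hc₁ r hr0
    have k2 := hc₂ r hr0
    have k3 := mul_le_mul_of_nonneg_left k2 (show 0 ≤ α * δ by positivity)
    have k4 := mul_le_mul_of_nonneg_left k1 (show 0 ≤ β * μ by positivity)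
    rw [hlog, hκdef, hDdef, hcdef]
    linarith
  have hlim : Tendsto (fun r => c - κ * Real.log r) atTop atBot := by
    have : Tendsto (fun r => κ * Real.log r) atTop atTop :=
      Real.tendsto_log_atTop.const_mul_atTop (by rw [hκdef]; linarith)
    exact tendsto_atBot_add_const_left _ c (tendsto_neg_atTop_atBot.comp this)
  obtain ⟨r, hr⟩ := ((hlim.eventually (eventually_lt_atBot (D * Real.log (E 2 / C)))).and
    (eventually_ge_atTop 2)).exists
  exact absurd (hdec r hr.2) (not_le.2 hr.1)

/-- Symmetric form of `not_isPosHalf_of_le`. -/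
theorem not_isPosHalf {n : ℕ} (hn : 1 ≤ n) {α β δ μ : ℝ} (hα : 1 ≤ α) (hβ : 1 ≤ β)
    (hnα : n * α < n + 2) (hnβ : n * β < n + 2) (hδ : 0 < δ) (hμ : 0 < μ)
    (hD : 0 < α * β * δ * μ - 1)
    (hsub : n * max α β - 1 < (n + 1) * (1 / (δ + 1) + 1 / (μ + 1))) {u v f g : ℝ → ℝ}
    (h1 : IsPosHalf n α δ u f v) (h2 : IsPosHalf n β μ v g u) : False := by
  rcases le_total β α with h | h
  · rw [max_eq_left h] at hsub
    exact not_isPosHalf_of_le hn hβ h hnα hδ hμ hD hsub h1 h2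
  · rw [max_eq_right h] at hsub
    refine not_isPosHalf_of_le hn hα h hnβ hμ hδ (by linarith) ?_ h2 h1
    rwa [add_comm (1 / (μ + 1))]

/-- The power `δ` of the positive part of `w`. -/
noncomputable def plusPow (δ : ℝ) (w : ℝ → ℝ) (t : ℝ) : ℝ := (max (w t) 0) ^ δ

section plusPow

variable {δ M : ℝ} {w w' : ℝ → ℝ}

theorem plusPow_mono (hδ : 0 < δ) {t : ℝ} (h : w t ≤ w' t) : plusPow δ w t ≤ plusPow δ w' t :=
  Real.rpow_le_rpow (le_max_right _ _) (max_le_max_right _ h) hδ.le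

theorem isBddSource_plusPow (hδ : 0 < δ) (hM : 0 ≤ M) (hw : Measurable w) (hle : ∀ t, w t ≤ M) :
    IsBddSource (plusPow δ w) (M ^ δ) :=
  ⟨(hw.max measurable_const).pow_const δ, fun t => ⟨Real.rpow_nonneg (le_max_right _ _) _,
    Real.rpow_le_rpow (le_max_right _ _) (max_le (hle t) hM) hδ.le⟩⟩

theorem continuous_plusPow (hδ : 0 < δ) (hw : Continuous w) : Continuous (plusPow δ w) :=
  (hw.max continuous_const).rpow_const fun _ => Or.inr hδ.le

theorem plusPow_of_nonneg {t : ℝ} (h : 0 ≤ w t) : plusPow δ w t = w t ^ δ := by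
  rw [plusPow, max_eq_left h]

theorem tendsto_plusPow (hδ : 0 < δ) {W : ℕ → ℝ → ℝ} {t : ℝ}
    (h : Tendsto (fun k => W k t) atTop (𝓝 (w t))) :
    Tendsto (fun k => plusPow δ (W k) t) atTop (𝓝 (plusPow δ w t)) :=
  (h.max tendsto_const_nhds).rpow_const (Or.inr hδ.le)

end plusPow

/-- The admissible parameters of the shooting problem. -/
structure ShootParams (n : ℕ) (α β δ μ : ℝ) : Prop where
  one_le_n : 1 ≤ n
  one_le_α : 1 ≤ α
  one_le_β : 1 ≤ β
  δ_pos : 0 < δ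
  μ_pos : 0 < μ

/-- The second component of a shooting solution, determined by the first one. -/
noncomputable def secondComp (n : ℕ) (β μ : ℝ) (w : ℝ → ℝ) (r : ℝ) : ℝ :=
  1 - radialPot n β (plusPow μ w) r

/-- The map whose fixed points are the first components of shooting solutions. -/
noncomputable def shootMap (n : ℕ) (α β δ μ a : ℝ) (w : ℝ → ℝ) (r : ℝ) : ℝ :=
  a - radialPot n α (plusPow δ (secondComp n β μ w)) r

/-- First components of solutions of the radial initial value problem with data `(a, 1)`. -/
structure IsShoot (n : ℕ) (α β δ μ a : ℝ) (u : ℝ → ℝ) : Prop where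
  measurable : Measurable u
  le : ∀ r, u r ≤ a
  eq : ∀ r, u r = shootMap n α β δ μ a u r

namespace ShootParams

variable {n : ℕ} {α β δ μ a M : ℝ} {w w' : ℝ → ℝ}

theorem secondComp_le_one (P : ShootParams n α β δ μ) (hM : 0 ≤ M) (hw : Measurable w)
    (hle : ∀ t, w t ≤ M) (r : ℝ) : secondComp n β μ w r ≤ 1 :=
  sub_le_self _ ((isBddSource_plusPow P.μ_pos hM hw hle).pot_nonneg P.one_le_n P.one_le_β r)

theorem secondComp_continuous (P : ShootParams n α β δ μ) (hM : 0 ≤ M) (hw : Measurable w)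
    (hle : ∀ t, w t ≤ M) : Continuous (secondComp n β μ w) :=
  continuous_const.sub
    ((isBddSource_plusPow P.μ_pos hM hw hle).pot_continuous P.one_le_n P.one_le_β)

theorem secondComp_source (P : ShootParams n α β δ μ) (hM : 0 ≤ M) (hw : Measurable w)
    (hle : ∀ t, w t ≤ M) : IsBddSource (plusPow δ (secondComp n β μ w)) 1 := by
  have := isBddSource_plusPow P.δ_pos zero_le_one (P.secondComp_continuous hM hw hle).measurable
    (P.secondComp_le_one hM hw hle)
  rwa [Real.one_rpow] at this

theorem secondComp_anti (P : ShootParams n α β δ μ) (hM : 0 ≤ M) (hw : Measurable w)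
    (hle : ∀ t, w t ≤ M) (hw' : Measurable w') (hle' : ∀ t, w' t ≤ M) (h : ∀ t, w t ≤ w' t)
    (r : ℝ) : secondComp n β μ w' r ≤ secondComp n β μ w r :=
  sub_le_sub_left ((isBddSource_plusPow P.μ_pos hM hw hle).pot_mono
    (isBddSource_plusPow P.μ_pos hM hw' hle') P.one_le_n P.one_le_β
    fun t _ _ => plusPow_mono P.μ_pos (h t)) 1

theorem shootMap_le (P : ShootParams n α β δ μ) (hM : 0 ≤ M) (hw : Measurable w)
    (hle : ∀ t, w t ≤ M) (r : ℝ) : shootMap n α β δ μ a w r ≤ a :=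
  sub_le_self _ ((P.secondComp_source hM hw hle).pot_nonneg P.one_le_n P.one_le_α r)

theorem le_shootMap (P : ShootParams n α β δ μ) (hM : 0 ≤ M) (hw : Measurable w)
    (hle : ∀ t, w t ≤ M) (r : ℝ) :
    a - radialPot n α (fun _ => 1) r ≤ shootMap n α β δ μ a w r :=
  sub_le_sub_left ((P.secondComp_source hM hw hle).pot_mono (isBddSource_const zero_le_one)
    P.one_le_n P.one_le_α fun t _ _ => (P.secondComp_source hM hw hle).le t) a

theorem shootMap_continuous (P : ShootParams n α β δ μ) (hM : 0 ≤ M) (hw : Measurable w)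
    (hle : ∀ t, w t ≤ M) : Continuous (shootMap n α β δ μ a w) :=
  continuous_const.sub ((P.secondComp_source hM hw hle).pot_continuous P.one_le_n P.one_le_α)

theorem shootMap_mono (P : ShootParams n α β δ μ) (hM : 0 ≤ M) {a' : ℝ} (ha : a ≤ a')
    (hw : Measurable w) (hle : ∀ t, w t ≤ M) (hw' : Measurable w') (hle' : ∀ t, w' t ≤ M)
    (h : ∀ t, w t ≤ w' t) (r : ℝ) : shootMap n α β δ μ a w r ≤ shootMap n α β δ μ a' w' r :=
  sub_le_sub ha ((P.secondComp_source hM hw' hle').pot_mono (P.secondComp_source hM hw hle)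
    P.one_le_n P.one_le_α
    fun t _ _ => plusPow_mono P.δ_pos (P.secondComp_anti hM hw hle hw' hle' h t))

theorem tendsto_secondComp (P : ShootParams n α β δ μ) (hM : 0 ≤ M) {W : ℕ → ℝ → ℝ}
    (hW : ∀ k, Measurable (W k)) (hle : ∀ k t, W k t ≤ M)
    (hlim : ∀ t, Tendsto (fun k => W k t) atTop (𝓝 (w t))) (r : ℝ) :
    Tendsto (fun k => secondComp n β μ (W k) r) atTop (𝓝 (secondComp n β μ w r)) :=
  tendsto_const_nhds.sub (IsBddSource.tendsto_pot
    (fun k => isBddSource_plusPow P.μ_pos hM (hW k) (hle k))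
    (fun t => tendsto_plusPow P.μ_pos (hlim t)) P.one_le_n P.one_le_β r)

theorem tendsto_shootMap (P : ShootParams n α β δ μ) (hM : 0 ≤ M) {W : ℕ → ℝ → ℝ} {A : ℕ → ℝ}
    (hA : Tendsto A atTop (𝓝 a)) (hW : ∀ k, Measurable (W k)) (hle : ∀ k t, W k t ≤ M)
    (hlim : ∀ t, Tendsto (fun k => W k t) atTop (𝓝 (w t))) (r : ℝ) :
    Tendsto (fun k => shootMap n α β δ μ (A k) (W k) r) atTop
      (𝓝 (shootMap n α β δ μ a w r)) :=
  hA.sub (IsBddSource.tendsto_pot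
    (fun k => P.secondComp_source hM (hW k) (hle k))
    (fun t => tendsto_plusPow P.δ_pos (P.tendsto_secondComp hM hW hle hlim t))
    P.one_le_n P.one_le_α r)

/-- Bounded pointwise limits of approximate solutions are solutions. -/
theorem isShoot_of_tendsto (P : ShootParams n α β δ μ) (hM : 0 ≤ M) {W : ℕ → ℝ → ℝ} {A : ℕ → ℝ}
    (hA : Tendsto A atTop (𝓝 a)) (hW : ∀ k, Measurable (W k)) (hle : ∀ k t, W k t ≤ M)
    (hleA : ∀ k t, W k t ≤ A k)
    (hlim : ∀ t, Tendsto (fun k => W k t) atTop (𝓝 (w t)))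
    (hlim' : ∀ t, Tendsto (fun k => shootMap n α β δ μ (A k) (W k) t) atTop (𝓝 (w t))) :
    IsShoot n α β δ μ a w where
  measurable := measurable_of_tendsto_metrizable hW (tendsto_pi_nhds.2 hlim)
  le r := le_of_tendsto_of_tendsto' (hlim r) hA fun k => hleA k r
  eq r := tendsto_nhds_unique (hlim' r) (P.tendsto_shootMap hM hA hW hle hlim r)

end ShootParams

/-- Iteration of `shootMap` from the constant upper barrier. -/
noncomputable def shootIter (n : ℕ) (α β δ μ a : ℝ) : ℕ → ℝ → ℝ
  | 0 => fun _ => a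
  | k + 1 => shootMap n α β δ μ a (shootIter n α β δ μ a k)

/-- The maximal solution of the radial initial value problem with data `(a, 1)`. -/
noncomputable def shootSol (n : ℕ) (α β δ μ a : ℝ) (r : ℝ) : ℝ :=
  ⨅ k, shootIter n α β δ μ a k r

namespace ShootParams

variable {n : ℕ} {α β δ μ a : ℝ}

theorem shootIter_spec (P : ShootParams n α β δ μ) (ha : 0 ≤ a) (k : ℕ) :
    Measurable (shootIter n α β δ μ a k) ∧ (∀ r, shootIter n α β δ μ a k r ≤ a) ∧
      ∀ r, a - radialPot n α (fun _ => 1) r ≤ shootIter n α β δ μ a k r := by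
  induction k with
  | zero =>
    refine ⟨measurable_const, fun _ => le_rfl, fun r => sub_le_self _ ?_⟩
    exact (isBddSource_const zero_le_one).pot_nonneg P.one_le_n P.one_le_α r
  | succ k ih =>
    exact ⟨(P.shootMap_continuous ha ih.1 ih.2.1).measurable, P.shootMap_le ha ih.1 ih.2.1,
      P.le_shootMap ha ih.1 ih.2.1⟩

theorem shootIter_antitone (P : ShootParams n α β δ μ) (ha : 0 ≤ a) (r : ℝ) :
    Antitone fun k => shootIter n α β δ μ a k r := by
  refine antitone_nat_of_succ_le fun k => ?_
  induction k generalizing r with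
  | zero => exact (P.shootIter_spec ha 1).2.1 r
  | succ k ih =>
    exact P.shootMap_mono ha le_rfl (P.shootIter_spec ha (k + 1)).1
      (P.shootIter_spec ha (k + 1)).2.1 (P.shootIter_spec ha k).1 (P.shootIter_spec ha k).2.1 ih r

theorem shootIter_bddBelow (P : ShootParams n α β δ μ) (ha : 0 ≤ a) (r : ℝ) :
    BddBelow (range fun k => shootIter n α β δ μ a k r) :=
  ⟨_, forall_mem_range.2 fun k => (P.shootIter_spec ha k).2.2 r⟩

theorem tendsto_shootIter (P : ShootParams n α β δ μ) (ha : 0 ≤ a) (r : ℝ) :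
    Tendsto (fun k => shootIter n α β δ μ a k r) atTop (𝓝 (shootSol n α β δ μ a r)) :=
  tendsto_atTop_ciInf (P.shootIter_antitone ha r) (P.shootIter_bddBelow ha r)

theorem isShoot_shootSol (P : ShootParams n α β δ μ) (ha : 0 ≤ a) :
    IsShoot n α β δ μ a (shootSol n α β δ μ a) :=
  P.isShoot_of_tendsto ha tendsto_const_nhds (fun k => (P.shootIter_spec ha k).1)
    (fun k => (P.shootIter_spec ha k).2.1) (fun k => (P.shootIter_spec ha k).2.1)
    (P.tendsto_shootIter ha) fun t => (P.tendsto_shootIter ha t).comp (tendsto_add_atTop_nat 1)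

theorem shootSol_mono (P : ShootParams n α β δ μ) (ha : 0 ≤ a) {a' : ℝ} (haa' : a ≤ a') (r : ℝ) :
    shootSol n α β δ μ a r ≤ shootSol n α β δ μ a' r := by
  have ha' := ha.trans haa'
  refine ciInf_mono (P.shootIter_bddBelow ha r) fun k => ?_
  induction k generalizing r with
  | zero => exact haa'
  | succ k ih =>
    exact P.shootMap_mono ha' haa' (P.shootIter_spec ha k).1
      (fun t => ((P.shootIter_spec ha k).2.1 t).trans haa') (P.shootIter_spec ha' k).1
      (P.shootIter_spec ha' k).2.1 ih r

end ShootParams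

/-- Real powers are Lipschitz on compact intervals away from the singularity. -/
theorem exists_rpow_sub_le {c ε M : ℝ} (hc : 0 < ε ∨ 1 ≤ c ∧ 0 ≤ ε) :
    ∃ L, 0 ≤ L ∧ ∀ x ∈ Icc ε M, ∀ y ∈ Icc ε M, x ≤ y → y ^ c - x ^ c ≤ L * (y - x) := by
  have hd : ∀ x ∈ Icc ε M, HasDerivAt (fun x : ℝ => x ^ c) (c * x ^ (c - 1)) x := fun x hx =>
    Real.hasDerivAt_rpow_const (hc.imp (fun h => (h.trans_le hx.1).ne') fun h => h.1)
  have hcont : ContinuousOn (fun x : ℝ => c * x ^ (c - 1)) (Icc ε M) :=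
    continuousOn_const.mul (continuousOn_id.rpow_const fun x hx =>
      hc.imp (fun h => (h.trans_le hx.1).ne') fun h => by linarith [h.1])
  obtain ⟨L, hL⟩ := isCompact_Icc.exists_bound_of_continuousOn hcont
  refine ⟨max L 0, le_max_right _ _, (convex_Icc ε M).image_sub_le_mul_sub_of_deriv_le
    (fun x hx => (hd x hx).continuousAt.continuousWithinAt)
    (fun x hx => (hd x (interior_subset hx)).differentiableAt.differentiableWithinAt)
    fun x hx => ?_⟩
  rw [(hd x (interior_subset hx)).deriv]
  exact (le_abs_self _).trans ((hL x (interior_subset hx)).trans (le_max_left _ _))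

theorem radialFlux_add_const {n : ℕ} (hn : 1 ≤ n) {h : ℝ → ℝ} {M : ℝ} (hh : IsBddSource h M)
    (c s : ℝ) :
    radialFlux n (fun t => h t + c) s = radialFlux n h s + c * max s 0 / (n + 1) := by
  rw [← radialFlux_const n hn]
  unfold radialFlux
  rw [← add_div, ← intervalIntegral.integral_add (hh.intervalIntegrable n _ _)
    (Continuous.intervalIntegrable (by fun_prop) _ _)]
  congr 2
  ext t
  ring

/-- Local Lipschitz estimate for powers of the flux, for ordered antitone sources. -/
theorem exists_flux_rpow_sub_le {n : ℕ} (hn : 1 ≤ n) {α δ M s₀ : ℝ} (hα : 1 ≤ α) (hδ : 0 < δ)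
    (hM : 0 ≤ M) {w w' : ℝ → ℝ} (hw : Measurable w) (hw' : Measurable w')
    (hle : ∀ t, w t ≤ w' t) (hwM : ∀ t, w' t ≤ M) (hanti : Antitone w)
    (hmono : Monotone fun t => w' t - w t) (hs₀ : 0 < s₀) (hpos : 0 < w s₀) :
    ∃ L, 0 ≤ L ∧ ∀ s ∈ Icc 0 s₀, (radialFlux n (plusPow δ w') s) ^ α
      - (radialFlux n (plusPow δ w) s) ^ α ≤ L * (w' s - w s) := by
  have hB := isBddSource_plusPow hδ hM hw fun t => (hle t).trans (hwM t)
  have hB' := isBddSource_plusPow hδ hM hw' hwM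
  obtain ⟨L₁, hL₁, h₁⟩ := exists_rpow_sub_le (c := δ) (M := M) (Or.inl hpos)
  obtain ⟨L₂, hL₂, h₂⟩ := exists_rpow_sub_le (c := α) (ε := 0) (M := M ^ δ * s₀)
    (Or.inr ⟨hα, le_rfl⟩)
  refine ⟨L₂ * (L₁ * s₀), by positivity, fun s hs => ?_⟩
  have hd : 0 ≤ w' s - w s := sub_nonneg.2 (hle s)
  have hflux : ∀ {h}, IsBddSource h (M ^ δ) → radialFlux n h s ∈ Icc 0 (M ^ δ * s₀) := by
    intro h hh
    refine ⟨hh.flux_nonneg s, (hh.flux_le hn s).trans ?_⟩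
    exact mul_le_mul_of_nonneg_left (max_le hs.2 hs₀.le) hh.bound_nonneg
  have hmonoF : radialFlux n (plusPow δ w) s ≤ radialFlux n (plusPow δ w') s :=
    hB.flux_mono hB' fun t _ _ => plusPow_mono hδ (hle t)
  refine (h₂ _ (hflux hB) _ (hflux hB') hmonoF).trans ?_
  rw [mul_assoc]
  refine mul_le_mul_of_nonneg_left ?_ hL₂
  set c := L₁ * (w' s - w s) with hc
  have hc0 : 0 ≤ c := by positivity
  have hBc : IsBddSource (fun t => plusPow δ w t + c) (M ^ δ + c) :=
    ⟨hB.1.add_const c, fun t => ⟨add_nonneg (hB.nonneg t) hc0, add_le_add_left (hB.le t) c⟩⟩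
  have key : radialFlux n (plusPow δ w') s ≤ radialFlux n (fun t => plusPow δ w t + c) s := by
    refine hB'.flux_mono hBc fun t _ hts => ?_
    have hwt : w s₀ ≤ w t := hanti (hts.trans hs.2)
    have hw't : 0 ≤ w' t := hpos.le.trans (hwt.trans (hle t))
    rw [plusPow_of_nonneg (hpos.le.trans hwt), plusPow_of_nonneg hw't]
    have h3 := h₁ (w t) ⟨hwt, (hle t).trans (hwM t)⟩ (w' t) ⟨hwt.trans (hle t), hwM t⟩ (hle t)
    have h4 : L₁ * (w' t - w t) ≤ c := mul_le_mul_of_nonneg_left (hmono hts) hL₁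
    linarith
  rw [radialFlux_add_const hn hB] at key
  have hs' : c * max s 0 / (n + 1) ≤ c * s₀ := by
    refine (div_le_self (mul_nonneg hc0 (le_max_right _ _)) (by simp)).trans ?_
    exact mul_le_mul_of_nonneg_left (max_le hs.2 hs₀.le) hc0
  have : L₁ * s₀ * (w' s - w s) = c * s₀ := by rw [hc]; ring
  linarith

/-- A nonnegative function vanishing at `0` with `D' ≤ K D` vanishes. -/
theorem eq_zero_of_deriv_le_mul {D D' : ℝ → ℝ} {K s₀ : ℝ} (hs₀ : 0 ≤ s₀) (h0 : D 0 = 0)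
    (hD : ∀ s, HasDerivAt D (D' s) s) (hle : ∀ s ∈ Icc 0 s₀, D' s ≤ K * D s)
    (hnn : 0 ≤ D s₀) : D s₀ = 0 := by
  have hd : ∀ s, HasDerivAt (fun s => Real.exp (-K * s) * D s)
      (Real.exp (-K * s) * (D' s - K * D s)) s := by
    intro s
    have h1 : HasDerivAt (fun s => -K * s) (-K) s := by simpa using (hasDerivAt_id s).const_mul (-K)
    refine (h1.exp.mul (hD s)).congr_deriv ?_
    ring
  have hanti : AntitoneOn (fun s => Real.exp (-K * s) * D s) (Icc 0 s₀) := by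
    refine antitoneOn_of_deriv_nonpos (convex_Icc 0 s₀)
      (fun s _ => (hd s).continuousAt.continuousWithinAt)
      (fun s _ => (hd s).differentiableAt.differentiableWithinAt) fun s hs => ?_
    rw [(hd s).deriv]
    exact mul_nonpos_of_nonneg_of_nonpos (Real.exp_pos _).le
      (by linarith [hle s (interior_subset hs)])
  have := hanti (left_mem_Icc.2 hs₀) (right_mem_Icc.2 hs₀) hs₀
  simp only [h0, mul_zero] at this
  exact le_antisymm (nonpos_of_mul_nonpos_right this (Real.exp_pos _)) hnn

/-- The flux of a continuous nonnegative source which is positive at the origin is positive. -/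
theorem radialFlux_pos {n : ℕ} {h : ℝ → ℝ} {M : ℝ} (hh : IsBddSource h M) (hc : Continuous h)
    (h0 : 0 < h 0) {s : ℝ} (hs : 0 < s) : 0 < radialFlux n h s := by
  rw [radialFlux, max_eq_left hs.le]
  refine div_pos ?_ (pow_pos hs n)
  have h1 : ∀ᶠ t in 𝓝[>] (0:ℝ), 0 < h t :=
    (hc.continuousAt.eventually (lt_mem_nhds h0)).filter_mono nhdsWithin_le_nhds
  obtain ⟨c, hc1, hc2⟩ := (h1.and (Ioo_mem_nhdsGT hs)).exists
  refine intervalIntegral.integral_pos hs (by fun_prop) (fun t ht => ?_)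
    ⟨c, Ioo_subset_Icc_self hc2, mul_pos (pow_pos hc2.1 n) hc1⟩
  exact mul_nonneg (pow_nonneg ht.1.le n) (hh.nonneg t)

/-- Assembling one half of a positive radial solution from the integral equations. -/
theorem isPosHalf_of_flux {n : ℕ} (hn : 1 ≤ n) {α δ M M' : ℝ} (hδ : 0 < δ)
    (hM : 0 ≤ M) {u v : ℝ → ℝ} (hvc : Continuous v) (hvM : ∀ t, v t ≤ M) (hva : Antitone v)
    (hv : ∀ r, 0 ≤ r → 0 < v r) (hu : ∀ r, 0 < r → 0 < u r) (huM : ∀ r, u r ≤ M')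
    (hd : ∀ r, HasDerivAt u (-(radialFlux n (plusPow δ v) r) ^ α) r) :
    IsPosHalf n α δ u (radialFlux n (plusPow δ v)) v := by
  have hB := isBddSource_plusPow hδ hM hvc.measurable hvM
  have hc := continuous_plusPow hδ hvc
  have hval : ∀ r, 0 ≤ r → plusPow δ v r = v r ^ δ := fun r hr => plusPow_of_nonneg (hv r hr).le
  refine ⟨hu, fun r hr => radialFlux_pos hB hc ?_ hr, fun r _ => hd r, fun r hr => ?_,
    fun r hr => ?_, ?_, M', fun r _ => huM r⟩
  · rw [hval 0 le_rfl]
    exact Real.rpow_pos_of_pos (hv 0 le_rfl) δ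
  · have := hasDerivAt_radialFlux (n := n) hc hr
    rwa [hval r hr.le] at this
  · have hcst : 0 ≤ v r ^ δ := Real.rpow_nonneg (hv r hr.le).le δ
    have h1 := (isBddSource_const hcst).flux_mono (n := n) hB (s := r) fun t ht htr => by
      rw [hval t ht]
      exact Real.rpow_le_rpow (hv r hr.le).le (hva htr) hδ.le
    rw [radialFlux_const n hn, max_eq_left hr.le, div_le_iff₀ (by positivity)] at h1
    linarith
  · have := (hB.flux_continuous hn).tendsto 0
    rw [radialFlux_of_nonpos le_rfl] at this
    exact this.mono_left nhdsWithin_le_nhds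

theorem exists_zero_of_nonpos {w : ℝ → ℝ} (hc : Continuous w) (h0 : 0 < w 0) {r : ℝ} (hr : 0 ≤ r)
    (hneg : w r ≤ 0) : ∃ ρ, 0 < ρ ∧ ρ ≤ r ∧ w ρ = 0 := by
  obtain ⟨ρ, hρ, hw⟩ := intermediate_value_Icc' hr hc.continuousOn ⟨hneg, h0.le⟩
  refine ⟨ρ, lt_of_le_of_ne hρ.1 ?_, hρ.2, hw⟩
  rintro rfl
  exact h0.ne' hw

namespace IsShoot

variable {n : ℕ} {α β δ μ a : ℝ} {u u₁ u₂ : ℝ → ℝ}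

theorem source_snd (h : IsShoot n α β δ μ a u) (P : ShootParams n α β δ μ) (ha : 0 < a) :
    IsBddSource (plusPow δ (secondComp n β μ u)) 1 :=
  P.secondComp_source ha.le h.measurable h.le

theorem source_fst (h : IsShoot n α β δ μ a u) (P : ShootParams n α β δ μ) (ha : 0 < a) :
    IsBddSource (plusPow μ u) (a ^ μ) :=
  isBddSource_plusPow P.μ_pos ha.le h.measurable h.le

theorem hasDerivAt_fst (h : IsShoot n α β δ μ a u) (P : ShootParams n α β δ μ) (ha : 0 < a)
    (r : ℝ) :
    HasDerivAt u (-(radialFlux n (plusPow δ (secondComp n β μ u)) r) ^ α) r :=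
  (((h.source_snd P ha).hasDerivAt_pot P.one_le_n P.one_le_α r).const_sub a).congr_of_eventuallyEq
    (Eventually.of_forall h.eq)

theorem hasDerivAt_snd (h : IsShoot n α β δ μ a u) (P : ShootParams n α β δ μ) (ha : 0 < a)
    (r : ℝ) :
    HasDerivAt (secondComp n β μ u) (-(radialFlux n (plusPow μ u) r) ^ β) r :=
  ((h.source_fst P ha).hasDerivAt_pot P.one_le_n P.one_le_β r).const_sub 1

theorem continuous_fst (h : IsShoot n α β δ μ a u) (P : ShootParams n α β δ μ) (ha : 0 < a) :
    Continuous u :=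
  continuous_iff_continuousAt.2 fun r => (h.hasDerivAt_fst P ha r).continuousAt

theorem continuous_snd (h : IsShoot n α β δ μ a u) (P : ShootParams n α β δ μ) (ha : 0 < a) :
    Continuous (secondComp n β μ u) :=
  continuous_iff_continuousAt.2 fun r => (h.hasDerivAt_snd P ha r).continuousAt

theorem fst_zero (h : IsShoot n α β δ μ a u) (P : ShootParams n α β δ μ) : u 0 = a := by
  rw [h.eq, shootMap, radialPot_of_nonpos P.one_le_α le_rfl, sub_zero]

theorem snd_zero (P : ShootParams n α β δ μ) : secondComp n β μ u 0 = 1 := by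
  rw [secondComp, radialPot_of_nonpos P.one_le_β le_rfl, sub_zero]

theorem antitone_fst (h : IsShoot n α β δ μ a u) (P : ShootParams n α β δ μ) (ha : 0 < a) :
    Antitone u :=
  antitone_of_deriv_nonpos (fun r => (h.hasDerivAt_fst P ha r).differentiableAt) fun r => by
    rw [(h.hasDerivAt_fst P ha r).deriv]
    exact neg_nonpos.2 (Real.rpow_nonneg ((h.source_snd P ha).flux_nonneg r) _)

theorem antitone_snd (h : IsShoot n α β δ μ a u) (P : ShootParams n α β δ μ) (ha : 0 < a) :
    Antitone (secondComp n β μ u) :=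
  antitone_of_deriv_nonpos (fun r => (h.hasDerivAt_snd P ha r).differentiableAt) fun r => by
    rw [(h.hasDerivAt_snd P ha r).deriv]
    exact neg_nonpos.2 (Real.rpow_nonneg ((h.source_fst P ha).flux_nonneg r) _)

theorem flux_snd_pos (h : IsShoot n α β δ μ a u) (P : ShootParams n α β δ μ) (ha : 0 < a)
    {r : ℝ} (hr : 0 < r) : 0 < radialFlux n (plusPow δ (secondComp n β μ u)) r := by
  refine radialFlux_pos (h.source_snd P ha) (continuous_plusPow P.δ_pos (h.continuous_snd P ha))
    ?_ hr
  simp [plusPow, snd_zero P]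

theorem flux_fst_pos (h : IsShoot n α β δ μ a u) (P : ShootParams n α β δ μ) (ha : 0 < a)
    {r : ℝ} (hr : 0 < r) : 0 < radialFlux n (plusPow μ u) r := by
  refine radialFlux_pos (h.source_fst P ha) (continuous_plusPow P.μ_pos (h.continuous_fst P ha))
    ?_ hr
  rw [plusPow, h.fst_zero P]
  positivity

theorem strictAntiOn_fst (h : IsShoot n α β δ μ a u) (P : ShootParams n α β δ μ) (ha : 0 < a) :
    StrictAntiOn u (Ici 0) :=
  strictAntiOn_of_deriv_neg (convex_Ici 0) (h.continuous_fst P ha).continuousOn fun r hr => by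
    rw [(h.hasDerivAt_fst P ha r).deriv]
    exact neg_neg_of_pos (Real.rpow_pos_of_pos (h.flux_snd_pos P ha (by simpa using hr)) _)

theorem strictAntiOn_snd (h : IsShoot n α β δ μ a u) (P : ShootParams n α β δ μ) (ha : 0 < a) :
    StrictAntiOn (secondComp n β μ u) (Ici 0) :=
  strictAntiOn_of_deriv_neg (convex_Ici 0) (h.continuous_snd P ha).continuousOn fun r hr => by
    rw [(h.hasDerivAt_snd P ha r).deriv]
    exact neg_neg_of_pos (Real.rpow_pos_of_pos (h.flux_fst_pos P ha (by simpa using hr)) _)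

theorem snd_le (h : IsShoot n α β δ μ a u) (P : ShootParams n α β δ μ) (ha : 0 < a) (r : ℝ) :
    secondComp n β μ u r ≤ 1 :=
  P.secondComp_le_one ha.le h.measurable h.le r

/-- Ordered solutions with the same data agree as long as the smaller components stay
positive. -/
theorem eq_of_le (h₁ : IsShoot n α β δ μ a u₁) (h₂ : IsShoot n α β δ μ a u₂)
    (P : ShootParams n α β δ μ) (ha : 0 < a) (hle : ∀ t, u₁ t ≤ u₂ t) {s : ℝ} (hs : 0 < s)
    (hu : 0 < u₁ s) (hv : 0 < secondComp n β μ u₂ s) :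
    u₁ s = u₂ s ∧ secondComp n β μ u₁ s = secondComp n β μ u₂ s := by
  have hlev := P.secondComp_anti ha.le h₁.measurable h₁.le h₂.measurable h₂.le hle
  have hdu := fun r => (h₂.hasDerivAt_fst P ha r).sub (h₁.hasDerivAt_fst P ha r)
  have hdv := fun r => (h₁.hasDerivAt_snd P ha r).sub (h₂.hasDerivAt_snd P ha r)
  have hmu : Monotone fun t => u₂ t - u₁ t :=
    monotone_of_deriv_nonneg (fun r => (hdu r).differentiableAt) fun r => by
      refine (hdu r).deriv.symm ▸ ?_
      have := Real.rpow_le_rpow ((h₂.source_snd P ha).flux_nonneg r)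
        ((h₂.source_snd P ha).flux_mono (n := n) (h₁.source_snd P ha) (s := r) fun t _ _ =>
          plusPow_mono P.δ_pos (hlev t)) (show 0 ≤ α by linarith [P.one_le_α])
      linarith
  have hmv : Monotone fun t => secondComp n β μ u₁ t - secondComp n β μ u₂ t :=
    monotone_of_deriv_nonneg (fun r => (hdv r).differentiableAt) fun r => by
      refine (hdv r).deriv.symm ▸ ?_
      have := Real.rpow_le_rpow ((h₁.source_fst P ha).flux_nonneg r)
        ((h₁.source_fst P ha).flux_mono (n := n) (h₂.source_fst P ha) (s := r) fun t _ _ =>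
          plusPow_mono P.μ_pos (hle t)) (show 0 ≤ β by linarith [P.one_le_β])
      linarith
  obtain ⟨L₁, hL₁, hb₁⟩ := exists_flux_rpow_sub_le P.one_le_n P.one_le_α P.δ_pos zero_le_one
    (h₂.continuous_snd P ha).measurable (h₁.continuous_snd P ha).measurable hlev
    (h₁.snd_le P ha) (h₂.antitone_snd P ha) hmv hs hv
  obtain ⟨L₂, hL₂, hb₂⟩ := exists_flux_rpow_sub_le P.one_le_n P.one_le_β P.μ_pos ha.le
    h₁.measurable h₂.measurable hle h₂.le (h₁.antitone_fst P ha) hmu hs hu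
  have hz := eq_zero_of_deriv_le_mul (K := L₁ + L₂) hs.le
    (by simp [h₁.fst_zero P, h₂.fst_zero P, snd_zero P]) (fun r => (hdu r).add (hdv r))
    (fun r hr => by
      have k1 := hb₁ r hr
      have k2 := hb₂ r hr
      have k3 := mul_nonneg hL₁ (sub_nonneg.2 (hle r))
      have k4 := mul_nonneg hL₂ (sub_nonneg.2 (hlev r))
      simp only [Pi.add_apply, Pi.sub_apply]
      linarith)
    (by
      have := hle s
      have := hlev s
      simp only [Pi.add_apply, Pi.sub_apply]
      linarith)
  simp only [Pi.add_apply, Pi.sub_apply] at hz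
  have := hle s
  have := hlev s
  constructor <;> linarith

/-- Ordered solutions with the same data cannot have their components vanish in opposite
orders. -/
theorem false_of_le (h₁ : IsShoot n α β δ μ a u₁) (h₂ : IsShoot n α β δ μ a u₂)
    (P : ShootParams n α β δ μ) (ha : 0 < a) (hle : ∀ t, u₁ t ≤ u₂ t)
    (hA : ∃ r, 0 < r ∧ u₁ r < 0 ∧ 0 < secondComp n β μ u₁ r)
    (hB : ∃ r, 0 < r ∧ 0 < u₂ r ∧ secondComp n β μ u₂ r < 0) : False := by
  obtain ⟨r, hr, hur, hvr⟩ := hA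
  obtain ⟨r', hr', hur', hvr'⟩ := hB
  obtain ⟨r₀, hr₀, hr₀r, hz₀⟩ := exists_zero_of_nonpos (h₁.continuous_fst P ha)
    (by rw [h₁.fst_zero P]; exact ha) hr.le hur.le
  obtain ⟨r₁, hr₁, hr₁r, hz₁⟩ := exists_zero_of_nonpos (h₂.continuous_snd P ha)
    (by rw [snd_zero P]; exact zero_lt_one) hr'.le hvr'.le
  have hv₀ := hvr.trans_le (h₁.antitone_snd P ha hr₀r)
  have hu₁ := hur'.trans_le (h₂.antitone_fst P ha hr₁r)
  have hm : 0 < min r₀ r₁ := lt_min hr₀ hr₁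
  have heq : ∀ s ∈ Ioo 0 (min r₀ r₁),
      u₁ s = u₂ s ∧ secondComp n β μ u₁ s = secondComp n β μ u₂ s := by
    intro s hs
    refine h₁.eq_of_le h₂ P ha hle hs.1 ?_ ?_
    · rw [← hz₀]
      exact h₁.strictAntiOn_fst P ha hs.1.le hr₀.le (hs.2.trans_le (min_le_left _ _))
    · rw [← hz₁]
      exact h₂.strictAntiOn_snd P ha hs.1.le hr₁.le (hs.2.trans_le (min_le_right _ _))
  have hlim : ∀ {w w' : ℝ → ℝ}, Continuous w → Continuous w' →
      (∀ s ∈ Ioo 0 (min r₀ r₁), w s = w' s) → w (min r₀ r₁) = w' (min r₀ r₁) := by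
    intro w w' hw hw' he
    refine tendsto_nhds_unique (f := w) (l := 𝓝[<] (min r₀ r₁))
      (hw.continuousAt.tendsto.mono_left nhdsWithin_le_nhds) ?_
    refine (hw'.continuousAt.tendsto.mono_left nhdsWithin_le_nhds).congr' ?_
    filter_upwards [Ioo_mem_nhdsLT hm] with s hs using (he s hs).symm
  have e1 := hlim (h₁.continuous_fst P ha) (h₂.continuous_fst P ha) fun s hs => (heq s hs).1
  have e2 := hlim (h₁.continuous_snd P ha) (h₂.continuous_snd P ha) fun s hs => (heq s hs).2
  rcases le_total r₀ r₁ with hle' | hle'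
  · rw [min_eq_left hle', hz₀] at e1
    have := h₂.antitone_fst P ha hle'
    linarith
  · rw [min_eq_right hle', hz₁] at e2
    have := h₁.antitone_snd P ha hle'
    linarith

end IsShoot

namespace IsShoot

variable {n : ℕ} {α β δ μ a : ℝ} {u : ℝ → ℝ}

/-- If neither component becomes negative while the other one is positive, then both vanish at the
same point. -/
theorem exists_common_zero (h : IsShoot n α β δ μ a u) (P : ShootParams n α β δ μ) (ha : 0 < a)
    (hgs : ∀ u v f g : ℝ → ℝ, IsPosHalf n α δ u f v → ¬ IsPosHalf n β μ v g u)
    (hA : ¬ ∃ r, 0 < r ∧ u r < 0 ∧ 0 < secondComp n β μ u r)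
    (hB : ¬ ∃ r, 0 < r ∧ 0 < u r ∧ secondComp n β μ u r < 0) :
    ∃ ρ, 0 < ρ ∧ u ρ = 0 ∧ secondComp n β μ u ρ = 0 := by
  have hc := h.continuous_fst P ha
  have hc' := h.continuous_snd P ha
  have h0 : 0 < u 0 := by rw [h.fst_zero P]; exact ha
  have h0' : 0 < secondComp n β μ u 0 := by rw [snd_zero P]; exact zero_lt_one
  by_cases hex : ∃ r, 0 ≤ r ∧ (u r ≤ 0 ∨ secondComp n β μ u r ≤ 0)
  · have hstep : ∀ {w w' : ℝ → ℝ}, Continuous w → Continuous w' → StrictAntiOn w (Ici 0) →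
        (¬ ∃ r, 0 < r ∧ w r < 0 ∧ 0 < w' r) → (¬ ∃ r, 0 < r ∧ 0 < w r ∧ w' r < 0) →
        ∀ ρ, 0 < ρ → w ρ = 0 → w' ρ = 0 := by
      intro w w' hw hw' hs h1 h2 ρ hρ hz
      rcases lt_trichotomy (w' ρ) 0 with hn | hn | hn
      · have : ∀ᶠ r in 𝓝[<] ρ, w' r < 0 :=
          (hw'.continuousAt.eventually (gt_mem_nhds hn)).filter_mono nhdsWithin_le_nhds
        obtain ⟨r, hr1, hr2⟩ := (this.and (Ioo_mem_nhdsLT hρ)).exists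
        refine (h2 ⟨r, hr2.1, ?_, hr1⟩).elim
        rw [← hz]
        exact hs hr2.1.le hρ.le hr2.2
      · exact hn
      · have : ∀ᶠ r in 𝓝[>] ρ, 0 < w' r :=
          (hw'.continuousAt.eventually (lt_mem_nhds hn)).filter_mono nhdsWithin_le_nhds
        obtain ⟨r, hr1, hr2⟩ := (this.and self_mem_nhdsWithin).exists
        have hr2 : ρ < r := hr2
        refine (h1 ⟨r, hρ.trans hr2, ?_, hr1⟩).elim
        rw [← hz]
        exact hs hρ.le (hρ.trans hr2).le hr2
    obtain ⟨r, hr, hr' | hr'⟩ := hex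
    · obtain ⟨ρ, hρ, -, hz⟩ := exists_zero_of_nonpos hc h0 hr hr'
      exact ⟨ρ, hρ, hz, hstep hc hc' (h.strictAntiOn_fst P ha) hA hB ρ hρ hz⟩
    · obtain ⟨ρ, hρ, -, hz⟩ := exists_zero_of_nonpos hc' h0' hr hr'
      refine ⟨ρ, hρ, hstep hc' hc (h.strictAntiOn_snd P ha) ?_ ?_ ρ hρ hz, hz⟩
      · rintro ⟨r, hr, h1, h2⟩
        exact hB ⟨r, hr, h2, h1⟩
      · rintro ⟨r, hr, h1, h2⟩
        exact hA ⟨r, hr, h2, h1⟩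
  · push Not at hex
    exact (hgs _ _ _ _
      (isPosHalf_of_flux P.one_le_n P.δ_pos zero_le_one hc' (h.snd_le P ha) (h.antitone_snd P ha)
        (fun r hr => (hex r hr).2) (fun r hr => (hex r hr.le).1) h.le (h.hasDerivAt_fst P ha))
      (isPosHalf_of_flux P.one_le_n P.μ_pos ha.le hc h.le (h.antitone_fst P ha)
        (fun r hr => (hex r hr).1) (fun r hr => (hex r hr.le).2) (h.snd_le P ha)
        (h.hasDerivAt_snd P ha))).elim

end IsShoot

namespace ShootParams

variable {n : ℕ} {α β δ μ : ℝ}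

/-- For small data the first component becomes negative first. -/
theorem exists_fst_neg (P : ShootParams n α β δ μ) : ∃ a, 0 < a ∧ ∀ u, IsShoot n α β δ μ a u →
    u 1 < 0 ∧ 0 < secondComp n β μ u 1 := by
  have hK := radialPot_one_pos P.one_le_n P.one_le_α
  have hlim : Tendsto (fun a : ℝ => (a ^ μ) ^ β * radialPot n β (fun _ => 1) 1) (𝓝[>] 0)
      (𝓝 0) := by
    have h1 : Tendsto (fun a : ℝ => (a ^ μ) ^ β) (𝓝 0) (𝓝 (((0:ℝ) ^ μ) ^ β)) :=
      (tendsto_id.rpow_const (Or.inr P.μ_pos.le)).rpow_const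
        (Or.inr (by linarith [P.one_le_β]))
    rw [Real.zero_rpow P.μ_pos.ne', Real.zero_rpow (by linarith [P.one_le_β])] at h1
    simpa using (h1.mono_left nhdsWithin_le_nhds).mul_const (radialPot n β (fun _ => 1) 1)
  have hK2 : 0 < ((1 / 2 : ℝ) ^ δ) ^ α * radialPot n α (fun _ => 1) 1 := by positivity
  obtain ⟨a, ha1, ha, ha2⟩ := ((hlim.eventually
    (gt_mem_nhds (show (0:ℝ) < 1 / 2 by norm_num))).and (Ioo_mem_nhdsGT hK2)).exists
  refine ⟨a, ha, fun u hu => ?_⟩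
  have hv : 1 / 2 ≤ secondComp n β μ u 1 := by
    have h1 := (hu.source_fst P ha).pot_mono (isBddSource_const (Real.rpow_nonneg ha.le μ))
      P.one_le_n P.one_le_β (r := 1) fun t _ _ => (hu.source_fst P ha).le t
    rw [radialPot_const _ _ (Real.rpow_nonneg ha.le μ)] at h1
    rw [secondComp]
    linarith
  refine ⟨?_, by linarith⟩
  have h2 := (isBddSource_const (show (0:ℝ) ≤ (1 / 2 : ℝ) ^ δ by positivity)).pot_mono
    (hu.source_snd P ha) P.one_le_n P.one_le_α (r := 1) fun t _ ht => by
      have := hv.trans (hu.antitone_snd P ha ht)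
      rw [plusPow_of_nonneg (by linarith)]
      exact Real.rpow_le_rpow (by norm_num) this P.δ_pos.le
  rw [radialPot_const _ _ (by positivity)] at h2
  rw [hu.eq, shootMap]
  linarith

/-- For large data the second component becomes negative first. -/
theorem exists_snd_neg (P : ShootParams n α β δ μ) : ∃ a, 0 < a ∧ ∀ u, IsShoot n α β δ μ a u →
    0 < u 1 ∧ secondComp n β μ u 1 < 0 := by
  have hK := radialPot_one_pos P.one_le_n P.one_le_β
  have hK' := radialPot_one_pos P.one_le_n P.one_le_α
  set K := radialPot n α (fun _ => 1) 1
  have hlim : Tendsto (fun b : ℝ => (b ^ μ) ^ β * radialPot n β (fun _ => 1) 1) atTop atTop :=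
    ((tendsto_rpow_atTop (by linarith [P.one_le_β])).comp
      (tendsto_rpow_atTop P.μ_pos)).atTop_mul_const hK
  obtain ⟨b, hb1, hb⟩ := ((hlim.eventually (eventually_gt_atTop 1)).and
    (eventually_gt_atTop 0)).exists
  have ha : 0 < K + b := by positivity
  refine ⟨K + b, ha, fun u hu => ?_⟩
  have hub : b ≤ u 1 := by
    have h1 := P.le_shootMap (a := K + b) ha.le hu.measurable hu.le 1
    rw [← hu.eq] at h1
    linarith
  refine ⟨hb.trans_le hub, ?_⟩
  have h2 := (isBddSource_const (Real.rpow_nonneg hb.le μ)).pot_mono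
    (hu.source_fst P ha) P.one_le_n P.one_le_β (r := 1) fun t _ ht => by
      have := hub.trans (hu.antitone_fst P ha ht)
      rw [plusPow_of_nonneg (hb.le.trans this)]
      exact Real.rpow_le_rpow hb.le this P.μ_pos.le
  rw [radialPot_const _ _ (Real.rpow_nonneg hb.le μ)] at h2
  rw [secondComp]
  linarith

/-- Monotone pointwise limits of the solutions `shootSol`, with convergence of both components. -/
theorem exists_tendsto_shootSol (P : ShootParams n α β δ μ) {a m M : ℝ} {A : ℕ → ℝ}
    (hm : 0 ≤ m) (hmA : ∀ k, m ≤ A k) (hAM : ∀ k, A k ≤ M) (hA : Tendsto A atTop (𝓝 a))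
    (hmono : Monotone A ∨ Antitone A) :
    ∃ w, IsShoot n α β δ μ a w ∧
      (∀ r, Tendsto (fun k => shootSol n α β δ μ (A k) r) atTop (𝓝 (w r))) ∧
      ∀ r, Tendsto (fun k => secondComp n β μ (shootSol n α β δ μ (A k)) r) atTop
        (𝓝 (secondComp n β μ w r)) := by
  have hA0 : ∀ k, 0 ≤ A k := fun k => hm.trans (hmA k)
  have hM : 0 ≤ M := (hA0 0).trans (hAM 0)
  have hS := fun k => P.isShoot_shootSol (hA0 k)
  have hlim : ∀ r, ∃ l, Tendsto (fun k => shootSol n α β δ μ (A k) r) atTop (𝓝 l) := by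
    intro r
    rcases hmono with h | h
    · exact ⟨_, tendsto_atTop_ciSup (fun i j hij => P.shootSol_mono (hA0 i) (h hij) r)
        ⟨shootSol n α β δ μ M r, forall_mem_range.2 fun k => P.shootSol_mono (hA0 k) (hAM k) r⟩⟩
    · exact ⟨_, tendsto_atTop_ciInf (fun i j hij => P.shootSol_mono (hA0 j) (h hij) r)
        ⟨shootSol n α β δ μ m r, forall_mem_range.2 fun k => P.shootSol_mono hm (hmA k) r⟩⟩
  choose w hw using hlim
  have hle : ∀ k t, shootSol n α β δ μ (A k) t ≤ M := fun k t => ((hS k).le t).trans (hAM k)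
  refine ⟨w, P.isShoot_of_tendsto hM hA (fun k => (hS k).measurable) hle (fun k => (hS k).le) hw
    fun t => (hw t).congr fun k => (hS k).eq t, hw,
    P.tendsto_secondComp hM (fun k => (hS k).measurable) hle hw⟩

/-- Some solution of the shooting problem has both components vanishing at the same point. -/
theorem exists_isShoot_common_zero (P : ShootParams n α β δ μ)
    (hgs : ∀ u v f g : ℝ → ℝ, IsPosHalf n α δ u f v → ¬ IsPosHalf n β μ v g u) :
    ∃ a u, 0 < a ∧ IsShoot n α β δ μ a u ∧
      ∃ ρ, 0 < ρ ∧ u ρ = 0 ∧ secondComp n β μ u ρ = 0 := by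
  set FstNeg : (ℝ → ℝ) → Prop := fun u => ∃ r, 0 < r ∧ u r < 0 ∧ 0 < secondComp n β μ u r
    with hFst
  set SndNeg : (ℝ → ℝ) → Prop := fun u => ∃ r, 0 < r ∧ 0 < u r ∧ secondComp n β μ u r < 0
    with hSnd
  have hexcl : ∀ a u, 0 < a → IsShoot n α β δ μ a u → FstNeg u → ¬ SndNeg u := by
    rintro a u ha hu h1 h2
    exact hu.false_of_le hu P ha (fun _ => le_rfl) h1 h2
  set A : Set ℝ := {a | 0 < a ∧ FstNeg (shootSol n α β δ μ a)} with hAdef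
  have hdown : ∀ a ∈ A, ∀ a', 0 < a' → a' ≤ a → a' ∈ A := by
    rintro a ⟨ha, r, hr, h1, h2⟩ a' ha' hle
    have hS := P.isShoot_shootSol ha.le
    have hS' := P.isShoot_shootSol ha'.le
    have hmono := P.shootSol_mono ha'.le hle
    exact ⟨ha', r, hr, (hmono r).trans_lt h1, h2.trans_le (P.secondComp_anti ha.le hS'.measurable
      (fun t => (hS'.le t).trans hle) hS.measurable hS.le hmono r)⟩
  obtain ⟨a₀, ha₀, h₀⟩ := P.exists_fst_neg
  obtain ⟨a₁, ha₁, h₁⟩ := P.exists_snd_neg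
  have hmem : a₀ ∈ A := ⟨ha₀, 1, zero_lt_one, h₀ _ (P.isShoot_shootSol ha₀.le)⟩
  have hbdd : BddAbove A := by
    refine ⟨a₁, fun a ha => ?_⟩
    by_contra hlt
    have := hdown a ha a₁ ha₁ (not_le.1 hlt).le
    exact hexcl a₁ _ ha₁ (P.isShoot_shootSol ha₁.le) this.2
      ⟨1, zero_lt_one, h₁ _ (P.isShoot_shootSol ha₁.le)⟩
  set s := sSup A with hs
  have hs0 : 0 < s := ha₀.trans_le (le_csSup hbdd hmem)
  obtain ⟨L, hLmono, hL, hLlim⟩ := exists_seq_strictMono_tendsto' hs0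
  obtain ⟨U, hUmono, hU, hUlim⟩ := exists_seq_strictAnti_tendsto' (show s < s + 1 by linarith)
  obtain ⟨u₁, hu₁, hf₁, hg₁⟩ := P.exists_tendsto_shootSol le_rfl (fun k => (hL k).1.le)
    (fun k => (hL k).2.le) hLlim (Or.inl hLmono.monotone)
  obtain ⟨u₂, hu₂, hf₂, hg₂⟩ := P.exists_tendsto_shootSol hs0.le (fun k => (hU k).1.le)
    (fun k => (hU k).2.le) hUlim (Or.inr hUmono.antitone)
  have hle : ∀ t, u₁ t ≤ u₂ t := fun t => le_of_tendsto_of_tendsto' (hf₁ t) (hf₂ t) fun k =>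
    P.shootSol_mono (hL k).1.le ((hL k).2.trans (hU k).1).le t
  have hLA : ∀ k, L k ∈ A := by
    intro k
    obtain ⟨a, ha, hlt⟩ := exists_lt_of_lt_csSup ⟨a₀, hmem⟩ (hL k).2
    exact hdown a ha _ (hL k).1 hlt.le
  have h1 : ¬ SndNeg u₁ := by
    rintro ⟨r, hr, k1, k2⟩
    obtain ⟨k, hk1, hk2⟩ := (((hf₁ r).eventually (lt_mem_nhds k1)).and
      ((hg₁ r).eventually (gt_mem_nhds k2))).exists
    exact hexcl _ _ (hL k).1 (P.isShoot_shootSol (hL k).1.le) (hLA k).2 ⟨r, hr, hk1, hk2⟩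
  have h2 : ¬ FstNeg u₂ := by
    rintro ⟨r, hr, k1, k2⟩
    obtain ⟨k, hk1, hk2⟩ := (((hf₂ r).eventually (gt_mem_nhds k1)).and
      ((hg₂ r).eventually (lt_mem_nhds k2))).exists
    have : U k ∈ A := ⟨hs0.trans (hU k).1, r, hr, hk1, hk2⟩
    exact absurd (le_csSup hbdd this) (not_le.2 (hU k).1)
  by_cases hcase : FstNeg u₁
  · refine ⟨s, u₂, hs0, hu₂, hu₂.exists_common_zero P hs0 hgs h2 fun hB => ?_⟩
    exact hu₁.false_of_le hu₂ P hs0 hle hcase hB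
  · exact ⟨s, u₁, hs0, hu₁, hu₁.exists_common_zero P hs0 hgs hcase h1⟩

end ShootParams

/-- One of the two equations of a regular radial solution, with source `v ^ δ`. -/
structure IsRadialComponent (N : ℕ) (p δ R : ℝ) (u v : ℝ → ℝ) : Prop where
  contDiffOn_one : ContDiffOn ℝ 1 u (Icc 0 R)
  contDiffOn_two : ContDiffOn ℝ 2 u (Ioc 0 R)
  pos : ∀ r ∈ Ico (0:ℝ) R, 0 < u r
  deriv_zero : deriv u 0 = 0
  eq_zero : u R = 0
  deriv_eq : ∀ r ∈ Ioc (0:ℝ) R,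
    deriv (fun s => s ^ ((N:ℝ) - 1) * |deriv u s| ^ (p - 2) * deriv u s) r
      = -(r ^ ((N:ℝ) - 1) * v r ^ δ)

namespace IsRadialComponent

variable {N : ℕ} {p q δ μ R : ℝ} {u v : ℝ → ℝ}

theorem isRadialSolution (hu : IsRadialComponent N p δ R u v) (hv : IsRadialComponent N q μ R v u) :
    IsRadialSolution N p q δ μ R u v :=
  ⟨hu.contDiffOn_one, hv.contDiffOn_one, hu.contDiffOn_two, hv.contDiffOn_two, hu.pos, hv.pos,
    hu.deriv_zero, hv.deriv_zero, hu.eq_zero, hv.eq_zero, hu.deriv_eq, hv.deriv_eq⟩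

theorem nonneg (hu : IsRadialComponent N p δ R u v) {r : ℝ} (hr : r ∈ Icc 0 R) : 0 ≤ u r := by
  rcases hr.2.eq_or_lt with h | h
  · rw [h, hu.eq_zero]
  · exact (hu.pos r ⟨hr.1, h⟩).le

theorem scale {l γ ξ : ℝ} (hl : 0 < l) (hu : IsRadialComponent N p δ (l * R) u v)
    (hv : ∀ r ∈ Icc 0 (l * R), 0 ≤ v r) (hγ : (p - 1) * γ + p = δ * ξ) :
    IsRadialComponent N p δ R (fun r => l ^ γ * u (l * r)) (fun r => l ^ ξ * v (l * r)) := by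
  have hmul : ContDiff ℝ 2 fun r : ℝ => l * r := contDiff_const.mul contDiff_id
  have hd : ∀ s, deriv (fun r => l ^ γ * u (l * r)) s = l ^ (γ + 1) * deriv u (l * s) := by
    intro s
    rw [deriv_const_mul_field, deriv_comp_mul_left, smul_eq_mul, Real.rpow_add_one hl.ne',
      mul_assoc]
  refine ⟨?_, ?_, fun r hr => ?_, ?_, ?_, fun r hr => ?_⟩
  · exact contDiffOn_const.mul (hu.contDiffOn_one.comp (hmul.of_le one_le_two).contDiffOn
      fun r hr => ⟨mul_nonneg hl.le hr.1, mul_le_mul_of_nonneg_left hr.2 hl.le⟩)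
  · exact contDiffOn_const.mul (hu.contDiffOn_two.comp hmul.contDiffOn
      fun r hr => ⟨mul_pos hl hr.1, mul_le_mul_of_nonneg_left hr.2 hl.le⟩)
  · exact mul_pos (Real.rpow_pos_of_pos hl _)
      (hu.pos _ ⟨mul_nonneg hl.le hr.1, mul_lt_mul_of_pos_left hr.2 hl⟩)
  · rw [hd, mul_zero, hu.deriv_zero, mul_zero]
  · rw [hu.eq_zero, mul_zero]
  · have hlr : l * r ∈ Ioc 0 (l * R) := ⟨mul_pos hl hr.1, mul_le_mul_of_nonneg_left hr.2 hl.le⟩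
    set G : ℝ → ℝ := fun s => s ^ ((N:ℝ) - 1) * |deriv u s| ^ (p - 2) * deriv u s with hG
    have hfun : (fun s => s ^ ((N:ℝ) - 1) * |deriv (fun r => l ^ γ * u (l * r)) s| ^ (p - 2) *
        deriv (fun r => l ^ γ * u (l * r)) s) =ᶠ[𝓝 r]
        fun s => (l ^ ((γ + 1) * (p - 1)) / l ^ ((N:ℝ) - 1)) * G (l * s) := by
      filter_upwards [lt_mem_nhds hr.1] with s hs
      have h1 : l ^ ((γ + 1) * (p - 1)) = l ^ ((γ + 1) * (p - 2)) * l ^ (γ + 1) := by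
        rw [← Real.rpow_add hl]
        ring_nf
      have h2 := Real.rpow_pos_of_pos hl ((N:ℝ) - 1)
      have h3 := Real.rpow_pos_of_pos hl (γ + 1)
      simp only [hd, hG]
      rw [abs_mul, abs_of_pos h3, Real.mul_rpow h3.le (abs_nonneg _), ← Real.rpow_mul hl.le,
        Real.mul_rpow hl.le hs.le, h1]
      field_simp
    rw [hfun.deriv_eq, deriv_const_mul_field, deriv_comp_mul_left, hu.deriv_eq _ hlr, smul_eq_mul,
      Real.mul_rpow hl.le hr.1.le, Real.mul_rpow (Real.rpow_pos_of_pos hl ξ).le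
      (hv _ (Ioc_subset_Icc_self hlr)), ← Real.rpow_mul hl.le, mul_comm ξ, ← hγ,
      show (p - 1) * γ + p = (γ + 1) * (p - 1) + 1 by ring, Real.rpow_add_one hl.ne']
    have h2 := Real.rpow_pos_of_pos hl ((N:ℝ) - 1)
    field_simp

/-- Regularity and the radial equation from the integrated form of the equation. -/
theorem of_flux {n : ℕ} (hn : 1 ≤ n) (hp1 : 1 < p) (hp2 : p ≤ 2) (hδ : 0 < δ) {M ρ : ℝ}
    (hM : 0 ≤ M) (hvc : Continuous v) (hvM : ∀ t, v t ≤ M)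
    (hpos : ∀ r, 0 < r → 0 < radialFlux n (plusPow δ v) r)
    (hd : ∀ r, HasDerivAt u (-(radialFlux n (plusPow δ v) r) ^ (1 / (p - 1))) r)
    (hu : ∀ r ∈ Ico 0 ρ, 0 < u r) (huρ : u ρ = 0) (hv : ∀ r ∈ Icc 0 ρ, 0 ≤ v r) :
    IsRadialComponent (n + 1) p δ ρ u v := by
  have hp : 0 < p - 1 := by linarith
  have hα : 1 ≤ 1 / (p - 1) := by
    rw [le_div_iff₀ hp]
    linarith
  have hB := isBddSource_plusPow hδ hM hvc.measurable hvM
  have hc := continuous_plusPow hδ hvc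
  have hderiv : deriv u = fun r => -(radialFlux n (plusPow δ v) r) ^ (1 / (p - 1)) :=
    funext fun r => (hd r).deriv
  have hflux : ContDiffOn ℝ 1 (radialFlux n (plusPow δ v)) (Ioi 0) := by
    have h1 : ∀ r ∈ Ioi (0:ℝ), deriv (radialFlux n (plusPow δ v)) r =
        plusPow δ v r - n * radialFlux n (plusPow δ v) r / r :=
      fun r hr => (hasDerivAt_radialFlux hc hr).deriv
    rw [show (1 : WithTop ℕ∞) = 0 + 1 by norm_num, contDiffOn_succ_iff_deriv_of_isOpen isOpen_Ioi]
    refine ⟨fun r hr => (hasDerivAt_radialFlux hc hr).differentiableAt.differentiableWithinAt,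
      by simp, contDiffOn_zero.2 (ContinuousOn.congr ?_ h1)⟩
    exact hc.continuousOn.sub ((continuousOn_const.mul (hB.flux_continuous hn).continuousOn).div
      continuousOn_id fun r hr => ne_of_gt hr)
  refine ⟨?_, ?_, hu, ?_, huρ, fun r hr => ?_⟩
  · refine (contDiff_one_iff_deriv.2 ⟨fun r => (hd r).differentiableAt, ?_⟩).contDiffOn
    rw [hderiv]
    exact (hB.flux_rpow_continuous hn hα).neg
  · refine ContDiffOn.mono (s := Ioi 0) ?_ fun r hr => hr.1
    rw [show (2 : WithTop ℕ∞) = 1 + 1 by norm_num, contDiffOn_succ_iff_deriv_of_isOpen isOpen_Ioi]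
    refine ⟨fun r _ => (hd r).differentiableAt.differentiableWithinAt, by simp, ?_⟩
    rw [hderiv]
    exact (hflux.rpow_const_of_ne fun r hr => (hpos r hr).ne').neg
  · rw [hderiv]
    simp only [radialFlux_of_nonpos le_rfl]
    rw [Real.zero_rpow (by positivity), neg_zero]
  · have hN : ((n + 1 : ℕ) : ℝ) - 1 = (n : ℝ) := by push_cast; ring
    have hfun : (fun s => s ^ (((n + 1 : ℕ) : ℝ) - 1) * |deriv u s| ^ (p - 2) * deriv u s) =ᶠ[𝓝 r]
        fun s => -(s ^ n * radialFlux n (plusPow δ v) s) := by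
      filter_upwards [lt_mem_nhds hr.1] with s hs
      have hf := hpos s hs
      rw [hderiv, hN, Real.rpow_natCast, abs_neg, abs_of_pos (Real.rpow_pos_of_pos hf _),
        ← Real.rpow_mul hf.le, mul_neg, mul_assoc, ← Real.rpow_add hf]
      have : 1 / (p - 1) * (p - 2) + 1 / (p - 1) = 1 := by
        field_simp
        ring
      rw [this, Real.rpow_one]
    rw [hfun.deriv_eq, (hasDerivAt_pow_mul_radialFlux hc hr.1).fun_neg.deriv, hN, Real.rpow_natCast,
      plusPow_of_nonneg (hv r (Ioc_subset_Icc_self hr))]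

end IsRadialComponent

/-- The exponents of the scaling invariance of the system. -/
theorem exists_scaling_exponents {p q δ μ : ℝ} (hD : 0 < δ * μ - (p - 1) * (q - 1)) :
    ∃ γ ξ : ℝ, (p - 1) * γ + p = δ * ξ ∧ (q - 1) * ξ + q = μ * γ := by
  obtain ⟨D, hDdef⟩ : ∃ D, D = δ * μ - (p - 1) * (q - 1) := ⟨_, rfl⟩
  rw [← hDdef] at hD
  refine ⟨(p * (q - 1) + q * δ) / D, (q * (p - 1) + p * μ) / D, ?_, ?_⟩ <;>
  · field_simp
    rw [hDdef]
    ring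

theorem exponent_bounds {n p : ℝ} (hn : 0 < n) (hp1 : 2 * (n + 1) / (n + 1 + 1) < p)
    (hp2 : p ≤ 2) : 1 < p ∧ 1 ≤ 1 / (p - 1) ∧ n * (1 / (p - 1)) < n + 2 := by
  rw [div_lt_iff₀ (by positivity)] at hp1
  have hp : 0 < p - 1 := by
    by_contra! h
    nlinarith
  refine ⟨by linarith, ?_, ?_⟩
  · rw [le_div_iff₀ hp]
    linarith
  · rw [mul_one_div, div_lt_iff₀ hp]
    linarith

theorem max_one_div_sub_one {p q : ℝ} (hp : 1 < p) (hq : 1 < q) :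
    max (1 / (p - 1)) (1 / (q - 1)) = 1 / (min p q - 1) := by
  rcases le_total p q with h | h
  · rw [min_eq_left h, max_eq_left (one_div_le_one_div_of_le (by linarith) (by linarith))]
  · rw [min_eq_right h, max_eq_right (one_div_le_one_div_of_le (by linarith) (by linarith))]

/-- A regular radial solution on some ball of positive radius, as two components. -/
theorem exists_isRadialComponent {n : ℕ} (hn : 1 ≤ n) {p q δ μ : ℝ} (hδ : 0 < δ) (hμ : 0 < μ)
    (hH1 : 0 < δ * μ - (p - 1) * (q - 1))
    (hp1 : 2 * ((n : ℝ) + 1) / (n + 1 + 1) < p) (hp2 : p ≤ 2)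
    (hq1 : 2 * ((n : ℝ) + 1) / (n + 1 + 1) < q) (hq2 : q ≤ 2)
    (hineq : ((n : ℝ) + 1 - min p q) / ((n + 1) * (min p q - 1)) < 1 / (δ + 1) + 1 / (μ + 1)) :
    ∃ ρ u v, 0 < ρ ∧ IsRadialComponent (n + 1) p δ ρ u v ∧
      IsRadialComponent (n + 1) q μ ρ v u := by
  have hn0 : (0:ℝ) < n := by exact_mod_cast hn
  obtain ⟨hp, hα, hnα⟩ := exponent_bounds hn0 hp1 hp2
  obtain ⟨hq, hβ, hnβ⟩ := exponent_bounds hn0 hq1 hq2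
  have hm : 0 < min p q - 1 := by linarith [lt_min hp hq]
  have hD : 0 < 1 / (p - 1) * (1 / (q - 1)) * δ * μ - 1 := by
    have h1 : 0 < p - 1 := by linarith
    have h2 : 0 < q - 1 := by linarith
    have : 1 / (p - 1) * (1 / (q - 1)) * δ * μ - 1 =
        (δ * μ - (p - 1) * (q - 1)) / ((p - 1) * (q - 1)) := by
      field_simp
    rw [this]
    positivity
  have hsub : n * max (1 / (p - 1)) (1 / (q - 1)) - 1 <
      (n + 1) * (1 / (δ + 1) + 1 / (μ + 1)) := by
    rw [max_one_div_sub_one hp hq]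
    refine lt_of_eq_of_lt ?_ (mul_lt_mul_of_pos_left hineq (by positivity))
    field_simp
    ring
  have P : ShootParams n (1 / (p - 1)) (1 / (q - 1)) δ μ := ⟨hn, hα, hβ, hδ, hμ⟩
  obtain ⟨a, u, ha, hu, ρ, hρ, huρ, hvρ⟩ := P.exists_isShoot_common_zero
    fun _ _ _ _ h₁ h₂ => not_isPosHalf hn hα hβ hnα hnβ hδ hμ hD hsub h₁ h₂
  have hu_pos : ∀ r ∈ Ico 0 ρ, 0 < u r := fun r hr =>
    huρ ▸ hu.strictAntiOn_fst P ha hr.1 hρ.le hr.2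
  have hv_pos : ∀ r ∈ Ico 0 ρ, 0 < secondComp n (1 / (q - 1)) μ u r := fun r hr =>
    hvρ ▸ hu.strictAntiOn_snd P ha hr.1 hρ.le hr.2
  refine ⟨ρ, u, secondComp n (1 / (q - 1)) μ u, hρ, ?_, ?_⟩
  · refine .of_flux hn hp hp2 hδ zero_le_one (hu.continuous_snd P ha) (hu.snd_le P ha)
      (fun r hr => hu.flux_snd_pos P ha hr) (hu.hasDerivAt_fst P ha) hu_pos huρ fun r hr => ?_
    exact hvρ ▸ hu.antitone_snd P ha hr.2
  · refine .of_flux hn hq hq2 hμ ha.le (hu.continuous_fst P ha) hu.le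
      (fun r hr => hu.flux_fst_pos P ha hr) (hu.hasDerivAt_snd P ha) hv_pos hvρ fun r hr => ?_
    exact huρ ▸ hu.antitone_fst P ha hr.2

/-- Theorem 1.4(1): existence of a regular radial solution to (S_R) in the subquadratic case. -/
theorem existence_subquadratic (N : ℕ) (hN : 2 ≤ N) (p q δ μ : ℝ)
    (hδ : 0 < δ) (hμ : 0 < μ) (hH1 : 0 < δ * μ - (p - 1) * (q - 1))
    (hp1 : 2 * (N : ℝ) / (N + 1) < p) (hp2 : p ≤ 2)
    (hq1 : 2 * (N : ℝ) / (N + 1) < q) (hq2 : q ≤ 2)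
    (hineq : 1 / (δ + 1) + 1 / (μ + 1) > ((N : ℝ) - min p q) / (N * (min p q - 1))) :
    ∀ R : ℝ, 0 < R → ∃ u v : ℝ → ℝ, IsRadialSolution N p q δ μ R u v := by
  intro R hR
  obtain ⟨n, rfl⟩ := Nat.exists_eq_add_of_le' (one_le_two.trans hN)
  push_cast at hp1 hq1 hineq
  obtain ⟨ρ, u, v, hρ, hu, hv⟩ :=
    exists_isRadialComponent (by lia) hδ hμ hH1 hp1 hp2 hq1 hq2 hineq
  obtain ⟨γ, ξ, hγ, hξ⟩ := exists_scaling_exponents hH1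
  have hl : 0 < ρ / R := div_pos hρ hR
  rw [← div_mul_cancel₀ ρ hR.ne'] at hu hv
  exact ⟨_, _, (hu.scale hl (fun r hr => hv.nonneg hr) hγ).isRadialSolution
    (hv.scale hl (fun r hr => hu.nonneg hr) hξ)⟩
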